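/- The following are equivalent: (i) C has the WLP; (ii) A has the WLP and property M_{q,p_1} holds for B. -/

import Mathlib

open MvPolynomial

set_option synthInstance.maxHeartbeats 1000000
set_option maxHeartbeats 1000000

noncomputable section

namespace SRWLP

variable (k : Type) [Field k]

/-- An (abstract) simplicial complex on the vertex set `Fin n`:
a collection of finite subsets (faces) closed under passing to subsets. -/
structure SC (n : ℕ) where
  faces : Finset (Finset (Fin n))
  down_closed : ∀ s ∈ faces, ∀ t ⊆ s, t ∈ faces

variable {n : ℕ}

/-- `dimP D = dim D + 1`, i.e. the maximal cardinality of a face of `D`. -/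
def dimP (D : SC n) : ℕ := D.faces.sup Finset.card

/-- The Stanley–Reisner ideal of `D`: the ideal generated by the squarefree
monomials corresponding to non-faces. -/
def srIdeal (D : SC n) : Ideal (MvPolynomial (Fin n) k) :=
  Ideal.span { p | ∃ s : Finset (Fin n), s ∉ D.faces ∧ p = ∏ i ∈ s, X i }

/-- `x_σ`, the product of the variables indexed by the face `σ`. -/
def xFace (σ : Finset (Fin n)) : MvPolynomial (Fin n) k := ∏ i ∈ σ, X i

variable {ι : Type} [Fintype ι]

/-- The degree-`m` graded component of the standard graded algebra
`k[Xᵢ : i ∈ ι] ⧸ J`, as a `k`-submodule. -/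
def qComp (J : Ideal (MvPolynomial ι k)) (m : ℕ) :
    Submodule k (MvPolynomial ι k ⧸ J) :=
  (homogeneousSubmodule ι k m).map (Ideal.Quotient.mkₐ k J).toLinearMap

/-- Graded components indexed by `ℤ` (zero in negative degrees). -/
def qCompZ (J : Ideal (MvPolynomial ι k)) (m : ℤ) :
    Submodule k (MvPolynomial ι k ⧸ J) :=
  if 0 ≤ m then qComp k J m.toNat else ⊥

/-- The Hilbert function of `k[Xᵢ] ⧸ J`. -/
def HFq (J : Ideal (MvPolynomial ι k)) (m : ℕ) : ℕ := Module.finrank k (qComp k J m)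

/-- The Hilbert function, with `ℤ` argument. -/
def HFZ (J : Ideal (MvPolynomial ι k)) (m : ℤ) : ℕ := Module.finrank k (qCompZ k J m)

/-- A property `P` of tuples `c : τ → k` holds *generically* (i.e. for all choices
in a suitable nonempty Zariski-open subset of the affine space `k^τ`) if there is a
nonzero polynomial `g` such that `P c` holds whenever `g` does not vanish at `c`. -/
def Generic (τ : Type) (P : (τ → k) → Prop) : Prop :=
  ∃ g : MvPolynomial τ k, g ≠ 0 ∧ ∀ c : τ → k, eval c g ≠ 0 → P c

/-- The linear form with coefficient tuple `c`. -/
def linForm (c : ι → k) : MvPolynomial ι k := ∑ i, C (c i) * X i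

/-- The ideal `J` together with the `d` linear forms encoded by `c`. -/
def redIdeal (J : Ideal (MvPolynomial ι k)) {d : ℕ} (c : Fin d × ι → k) :
    Ideal (MvPolynomial ι k) :=
  J ⊔ Ideal.span (Set.range fun j : Fin d => linForm k fun i => c (j, i))

/-- `depth (k[Xᵢ]⧸J) ≥ t` : there is a regular sequence of length `t` consisting of
elements of the graded maximal ideal. -/
def depthGE (J : Ideal (MvPolynomial ι k)) (t : ℕ) : Prop :=
  ∃ rs : List (MvPolynomial ι k), rs.length = t ∧
    (∀ f ∈ rs, f ∈ Ideal.span (Set.range (X : ι → MvPolynomial ι k))) ∧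
    RingTheory.Sequence.IsRegular (MvPolynomial ι k ⧸ J)
      (rs.map (Ideal.Quotient.mk J))

/-- `k[Xᵢ]⧸J` is Cohen–Macaulay of Krull dimension `d`. -/
def isCM (J : Ideal (MvPolynomial ι k)) (d : ℕ) : Prop :=
  ringKrullDim (MvPolynomial ι k ⧸ J) = (d : ℕ) ∧ depthGE k J d

/-- The socle of `k[Xᵢ]⧸J` (the annihilator of the graded maximal ideal). -/
def socle (J : Ideal (MvPolynomial ι k)) : Submodule k (MvPolynomial ι k ⧸ J) :=
  ⨅ i : ι, LinearMap.ker (LinearMap.mulLeft k (Ideal.Quotient.mk J (X i)))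

/-- `k[Xᵢ]⧸J` is Artinian Gorenstein: Artinian with one-dimensional socle. -/
def artGor (J : Ideal (MvPolynomial ι k)) : Prop :=
  IsArtinianRing (MvPolynomial ι k ⧸ J) ∧ Module.finrank k (socle k J) = 1

/-- `k[Xᵢ]⧸J` is Gorenstein of Krull dimension `d`: it is Cohen–Macaulay of
dimension `d` and a general Artinian reduction is Artinian Gorenstein. -/
def isGor (J : Ideal (MvPolynomial ι k)) (d : ℕ) : Prop :=
  isCM k J d ∧ Generic k (Fin d × ι) fun c => artGor k (redIdeal k J c)

/-- Multiplication by `ω` from the degree-`m` component to the degree-`(m+1)`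
component of `k[Xᵢ]⧸J` has maximal rank (is injective or surjective). -/
def mulMaxRank (J : Ideal (MvPolynomial ι k)) (ω : MvPolynomial ι k ⧸ J) (m : ℕ) : Prop :=
  (∀ x ∈ qComp k J m, ω * x = 0 → x = 0) ∨
  (∀ y ∈ qComp k J (m + 1), ∃ x ∈ qComp k J m, ω * x = y)

/-- The Weak Lefschetz Property for the Artinian algebra `k[Xᵢ]⧸J`: for a general
linear form `ω`, multiplication `ω : (⧸J)ₘ → (⧸J)ₘ₊₁` has maximal rank for all `m`. -/
def artWLP (J : Ideal (MvPolynomial ι k)) : Prop :=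
  Generic k ι fun c => ∀ m : ℕ,
    mulMaxRank k J (Ideal.Quotient.mk J (linForm k c)) m

/-- The Weak Lefschetz Property for `k[Xᵢ]⧸J` of Krull dimension `d ≥ 1`:
Cohen–Macaulay, and a general Artinian reduction has the WLP. -/
def hasWLP (J : Ideal (MvPolynomial ι k)) (d : ℕ) : Prop :=
  isCM k J d ∧ Generic k (Fin d × ι) fun c => artWLP k (redIdeal k J c)

/-- The Strong Lefschetz Property for the Artinian algebra `k[Xᵢ]⧸J`. -/
def artSLP (J : Ideal (MvPolynomial ι k)) : Prop :=
  ∃ r : ℕ, qComp k J r ≠ ⊥ ∧ (∀ j : ℕ, r < j → qComp k J j = ⊥) ∧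
    (∀ i ≤ r, HFq k J i = HFq k J (r - i)) ∧
    Generic k ι fun c => ∀ i : ℕ, 2 * i ≤ r →
      (∀ x ∈ qComp k J i,
          Ideal.Quotient.mk J (linForm k c) ^ (r - 2 * i) * x = 0 → x = 0) ∧
      (∀ y ∈ qComp k J (r - i), ∃ x ∈ qComp k J i,
          Ideal.Quotient.mk J (linForm k c) ^ (r - 2 * i) * x = y)

/-- The Strong Lefschetz Property for `k[Xᵢ]⧸J` of Krull dimension `d ≥ 1`. -/
def hasSLP (J : Ideal (MvPolynomial ι k)) (d : ℕ) : Prop :=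
  isCM k J d ∧ Generic k (Fin d × ι) fun c => artSLP k (redIdeal k J c)

/-- `D` is Gorenstein* over `k`: every element of the vertex set is a vertex,
`k[D]` is Gorenstein (of dimension `dim D + 1`), and for every vertex `i` there is a
face `τ` with `τ ∪ {i}` not a face. -/
def gorStar (D : SC n) : Prop :=
  (∀ i : Fin n, {i} ∈ D.faces) ∧
  isGor k (srIdeal k D) (dimP D) ∧
  (∀ i : Fin n, ∃ τ ∈ D.faces, insert i τ ∉ D.faces)

/-! `R[T]` is modelled as the polynomial ring in `n+1` variables, the last
variable playing the role of `T`. -/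

/-- The inclusion `R = k[x₁,…,xₙ] → R[T] = k[x₁,…,xₙ,T]`. -/
def toT : MvPolynomial (Fin n) k →ₐ[k] MvPolynomial (Fin (n + 1)) k :=
  rename Fin.castSucc

/-- The variable `T` of `R[T]`. -/
def Tv (n : ℕ) : MvPolynomial (Fin (n + 1)) k := X (Fin.last n)

/-- Extension of an ideal of `R` to `R[T]`. -/
def extI (J : Ideal (MvPolynomial (Fin n) k)) : Ideal (MvPolynomial (Fin (n + 1)) k) :=
  Ideal.map (toT k) J

/-- The ideal `T·J` of `R[T]`, for an ideal `J` of `R`. -/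
def TmulI (J : Ideal (MvPolynomial (Fin n) k)) : Ideal (MvPolynomial (Fin (n + 1)) k) :=
  Ideal.span ((fun f => Tv k n * toT k f) '' (J : Set (MvPolynomial (Fin n) k)))

/-- `I_L = (I_D : x_σ)`, the Stanley–Reisner ideal of the link of `σ` in `D`
(extended to `R`). -/
def linkIdeal (D : SC n) (σ : Finset (Fin n)) : Ideal (MvPolynomial (Fin n) k) :=
  Submodule.colon (srIdeal k D) (Ideal.span {xFace k σ})

/-- `J_st = (I, x_σ, T·I_L) ⊂ R[T]`, the Stanley–Reisner ideal of the stellar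
subdivision `D_σ`. -/
def Jst (D : SC n) (σ : Finset (Fin n)) : Ideal (MvPolynomial (Fin (n + 1)) k) :=
  extI k (srIdeal k D) ⊔ Ideal.span {toT k (xFace k σ)} ⊔ TmulI k (linkIdeal k D σ)

/-- `I_C = (I, T^{q+1}, T·I_L) ⊂ R[T]`. -/
def IC (D : SC n) (σ : Finset (Fin n)) (q : ℕ) : Ideal (MvPolynomial (Fin (n + 1)) k) :=
  extI k (srIdeal k D) ⊔ Ideal.span {Tv k n ^ (q + 1)} ⊔ TmulI k (linkIdeal k D σ)

/-- `I_G = (I, T^{q+1} - x_σ, T·I_L) ⊂ R[T]`. -/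
def IG (D : SC n) (σ : Finset (Fin n)) (q : ℕ) : Ideal (MvPolynomial (Fin (n + 1)) k) :=
  extI k (srIdeal k D) ⊔ Ideal.span {Tv k n ^ (q + 1) - toT k (xFace k σ)} ⊔
    TmulI k (linkIdeal k D σ)

/-- The ideal of `R[T]` generated by `d` general linear forms of `R`
(involving only the `x`-variables). -/
def xForms {d : ℕ} (c : Fin d × Fin n → k) : Ideal (MvPolynomial (Fin (n + 1)) k) :=
  Ideal.span (Set.range fun j : Fin d => toT k (linForm k fun i => c (j, i)))

/-- Property `M_{q,p₁}` for the Artinian algebra `B = R⧸J_B`: for a general linear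
form `ω`, multiplication by `ω^q : B_{p₁-q} → B_{p₁}` is injective. -/
def propM (JB : Ideal (MvPolynomial (Fin n) k)) (q p₁ : ℕ) : Prop :=
  Generic k (Fin n) fun c => ∀ x ∈ qCompZ k JB ((p₁ : ℤ) - (q : ℤ)),
    Ideal.Quotient.mk JB (linForm k c) ^ q * x = 0 → x = 0

section Auxiliary

set_option linter.unusedSectionVars false

variable {k}

/-- An ideal closed under taking homogeneous components. -/
def IsHom (J : Ideal (MvPolynomial ι k)) : Prop :=
  ∀ p ∈ J, ∀ m, homogeneousComponent m p ∈ J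

lemma hc_of_mem {p : MvPolynomial ι k} {m : ℕ} (hp : p.IsHomogeneous m) :
    homogeneousComponent m p = p := by
  simpa using homogeneousComponent_of_mem (m := m) ((mem_homogeneousSubmodule m p).2 hp)

lemma hc_of_mem_ne {p : MvPolynomial ι k} {m t : ℕ} (hp : p.IsHomogeneous m) (h : t ≠ m) :
    homogeneousComponent t p = 0 := by
  simpa [h] using homogeneousComponent_of_mem (m := t) ((mem_homogeneousSubmodule m p).2 hp)

lemma hc_mul {h : MvPolynomial ι k} {t : ℕ} (hh : h.IsHomogeneous t)
    (p : MvPolynomial ι k) (m : ℕ) :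
    homogeneousComponent (t + m) (h * p) = h * homogeneousComponent m p := by
  conv_lhs => rw [← sum_homogeneousComponent p, Finset.mul_sum, map_sum]
  have e : ∀ i, homogeneousComponent (t + m) (h * homogeneousComponent i p) =
      if i = m then h * homogeneousComponent m p else 0 := by
    intro i
    have hi := hh.mul (homogeneousComponent_isHomogeneous i p)
    split_ifs with him
    · subst him; exact hc_of_mem hi
    · exact hc_of_mem_ne hi (by omega)
  simp_rw [e]
  rw [Finset.sum_ite_eq']
  split_ifs with hm
  · rfl
  · rw [homogeneousComponent_eq_zero m p (by simpa using hm), mul_zero]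

lemma hc_mul_lt {h : MvPolynomial ι k} {t : ℕ} (hh : h.IsHomogeneous t)
    (p : MvPolynomial ι k) {m : ℕ} (hm : m < t) :
    homogeneousComponent m (h * p) = 0 := by
  conv_lhs => rw [← sum_homogeneousComponent p, Finset.mul_sum, map_sum]
  refine Finset.sum_eq_zero fun i _ => ?_
  exact hc_of_mem_ne (hh.mul (homogeneousComponent_isHomogeneous i p)) (by omega)

lemma mem_of_hc {S : Ideal (MvPolynomial ι k)} {p : MvPolynomial ι k}
    (h : ∀ m, homogeneousComponent m p ∈ S) : p ∈ S := by
  rw [← sum_homogeneousComponent p]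
  exact Ideal.sum_mem _ fun i _ => h i

lemma isHom_span {s : Set (MvPolynomial ι k)} (h : ∀ p ∈ s, ∃ m, p.IsHomogeneous m) :
    IsHom (Ideal.span s) := by
  intro p hp m
  let _ : GradedAlgebra (homogeneousSubmodule ι k) := MvPolynomial.gradedAlgebra
  exact homogeneousComponent_mem_of_mem (Ideal.homogeneous_span _ s h) hp m

lemma IsHom.sup {I J : Ideal (MvPolynomial ι k)} (hI : IsHom I) (hJ : IsHom J) :
    IsHom (I ⊔ J) := by
  intro p hp m
  obtain ⟨a, ha, b, hb, rfl⟩ := Submodule.mem_sup.1 hp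
  rw [map_add]
  exact Submodule.add_mem_sup (hI a ha m) (hJ b hb m)

/-- Multiplication by `h` detects membership: the ideal `(J : h)`. -/
def colonE (J : Ideal (MvPolynomial ι k)) (h : MvPolynomial ι k) : Ideal (MvPolynomial ι k) :=
  Submodule.comap (LinearMap.mulLeft _ h) J

lemma mem_colonE {J : Ideal (MvPolynomial ι k)} {h p : MvPolynomial ι k} :
    p ∈ colonE J h ↔ h * p ∈ J := Iff.rfl

lemma IsHom.colonE {J : Ideal (MvPolynomial ι k)} (hJ : IsHom J) {h : MvPolynomial ι k} {t : ℕ}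
    (hh : h.IsHomogeneous t) : IsHom (colonE J h) := by
  intro p hp m
  rw [mem_colonE, ← hc_mul hh]
  exact hJ _ hp _

/-- A graded Nakayama lemma. -/
lemma graded_nakayama {S Q : Ideal (MvPolynomial ι k)} (hS : IsHom S) (hQ : IsHom Q)
    {z : MvPolynomial ι k} (hz : z.IsHomogeneous 1)
    (h : ∀ p ∈ S, ∃ r ∈ S, p - z * r ∈ Q) : S ≤ Q := by
  have key : ∀ m : ℕ, ∀ p ∈ S, p.IsHomogeneous m → p ∈ Q := by
    intro m
    induction m with
    | zero =>
      intro p hp hm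
      obtain ⟨r, hr, hpr⟩ := h p hp
      have := hQ _ hpr 0
      rwa [map_sub, hc_of_mem hm, hc_mul_lt hz r (by omega), sub_zero] at this
    | succ m ih =>
      intro p hp hm
      obtain ⟨r, hr, hpr⟩ := h p hp
      have := hQ _ hpr (1 + m)
      rw [map_sub, hc_mul hz, add_comm, hc_of_mem hm] at this
      have h2 := ih _ (hS r hr m) (homogeneousComponent_isHomogeneous m r)
      simpa using Q.add_mem this (Q.mul_mem_left z h2)
  intro p hp
  exact mem_of_hc fun m => key m _ (hS p hp m) (homogeneousComponent_isHomogeneous m p)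

lemma mem_sup_span_singleton' {R : Type*} [CommRing R] {J : Ideal R} {z p : R} :
    p ∈ J ⊔ Ideal.span {z} ↔ ∃ r, p - z * r ∈ J := by
  constructor
  · intro h
    obtain ⟨a, ha, b, hb, rfl⟩ := Submodule.mem_sup.1 h
    obtain ⟨r, rfl⟩ := Ideal.mem_span_singleton'.1 hb
    exact ⟨r, by rwa [mul_comm z, add_sub_cancel_right]⟩
  · rintro ⟨r, hr⟩
    have h2 : z * r ∈ Ideal.span {z} := Ideal.mul_mem_right _ _ (Ideal.mem_span_singleton_self z)
    simpa using Submodule.add_mem_sup hr h2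

/-- `z` is a nonzerodivisor modulo `J`. -/
def Reg {R : Type*} [CommRing R] (J : Ideal R) (z : R) : Prop := ∀ p, z * p ∈ J → p ∈ J

lemma Reg.congr {R : Type*} [CommRing R] {J : Ideal R} {a b : R} (h : Reg J a)
    (hab : b - a ∈ J) : Reg J b := by
  intro p hp
  apply h
  have : a * p = b * p - (b - a) * p := by ring
  rw [this]
  exact J.sub_mem hp (J.mul_mem_right _ hab)

lemma Reg.swap {R : Type*} [CommRing R] {J : Ideal R} {z w : R} (hz : Reg J z)
    (hw : Reg (J ⊔ Ideal.span {z}) w) : Reg (J ⊔ Ideal.span {w}) z := by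
  intro m hm
  obtain ⟨m', h1⟩ := mem_sup_span_singleton'.1 hm
  have h2 : m' ∈ J ⊔ Ideal.span {z} := by
    apply hw
    refine mem_sup_span_singleton'.2 ⟨m, ?_⟩
    rw [← neg_sub]
    exact J.neg_mem h1
  obtain ⟨m'', h3⟩ := mem_sup_span_singleton'.1 h2
  refine mem_sup_span_singleton'.2 ⟨m'', hz _ ?_⟩
  have : z * (m - w * m'') = (z * m - w * m') + w * (m' - z * m'') := by ring
  rw [this]
  exact J.add_mem h1 (J.mul_mem_left _ h3)

lemma Reg.of_quotient {J : Ideal (MvPolynomial ι k)} (hJ : IsHom J) {z h : MvPolynomial ι k}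
    (hz1 : z.IsHomogeneous 1) (hh1 : h.IsHomogeneous 1) (hz : Reg J z)
    (hh : Reg (J ⊔ Ideal.span {z}) h) : Reg J h := by
  refine graded_nakayama (hJ.colonE hh1) hJ hz1 fun p hp => ?_
  have hp' : h * p ∈ J := hp
  obtain ⟨r, hr⟩ := mem_sup_span_singleton'.1 (hh p (Ideal.mem_sup_left hp'))
  refine ⟨r, ?_, hr⟩
  apply hz
  change z * (h * r) ∈ J
  have : z * (h * r) = h * p - h * (p - z * r) := by ring
  rw [this]
  exact J.sub_mem hp' (J.mul_mem_left _ hr)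

lemma linForm_add (a b : ι → k) : linForm k (a + b) = linForm k a + linForm k b := by
  simp [linForm, add_mul, Finset.sum_add_distrib]

lemma linForm_smul (t : k) (a : ι → k) : linForm k (t • a) = C t * linForm k a := by
  simp [linForm, Finset.mul_sum, mul_assoc]

lemma linForm_isHomogeneous (a : ι → k) : (linForm k a).IsHomogeneous 1 := by
  refine IsHomogeneous.sum _ _ _ fun i _ => ?_
  simpa using (isHomogeneous_C ι (a i)).mul (isHomogeneous_X k i)

/-- The ideal generated by a space of linear forms. -/
def LI (U : Submodule k (ι → k)) : Ideal (MvPolynomial ι k) :=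
  Ideal.span (linForm k '' U)

lemma linForm_mem_LI {U : Submodule k (ι → k)} {h : ι → k} (hh : h ∈ U) :
    linForm k h ∈ LI U := Ideal.subset_span ⟨h, hh, rfl⟩

lemma LI_isHom (U : Submodule k (ι → k)) : IsHom (LI U) := by
  refine isHom_span ?_
  rintro _ ⟨h, -, rfl⟩
  exact ⟨1, linForm_isHomogeneous h⟩

lemma LI_span (s : Set (ι → k)) : LI (Submodule.span k s) = Ideal.span (linForm k '' s) := by
  refine le_antisymm (Ideal.span_le.2 ?_) (Ideal.span_mono (Set.image_mono Submodule.subset_span))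
  rintro _ ⟨h, hh, rfl⟩
  induction hh using Submodule.span_induction with
  | mem x hx => exact Ideal.subset_span ⟨x, hx, rfl⟩
  | zero =>
    have : linForm k (0 : ι → k) = 0 := by simp [linForm]
    rw [this]; exact Ideal.zero_mem _
  | add x y _ _ hx hy => rw [linForm_add]; exact Ideal.add_mem _ hx hy
  | smul a x _ hx => rw [linForm_smul]; exact Ideal.mul_mem_left _ _ hx

lemma LI_singleton (z : ι → k) : LI (k ∙ z) = Ideal.span {linForm k z} := by
  rw [LI_span, Set.image_singleton]

lemma LI_sup (U W : Submodule k (ι → k)) : LI (U ⊔ W) = LI U ⊔ LI W := by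
  have : U ⊔ W = Submodule.span k ((U : Set (ι → k)) ∪ W) := by
    rw [Submodule.span_union, Submodule.span_eq, Submodule.span_eq]
  rw [this, LI_span, Set.image_union, Ideal.span_union]; rfl

lemma LI_bot : LI (⊥ : Submodule k (ι → k)) = ⊥ := by
  rw [eq_bot_iff, LI, Ideal.span_le]
  rintro _ ⟨h, hh, rfl⟩
  have : h = 0 := by simpa using hh
  subst this
  simp [linForm]

lemma subspace_ascending {U : Submodule k (ι → k)} {Q : Submodule k (ι → k) → Prop}
    (h0 : Q ⊥) (h1 : ∀ W ≤ U, ∀ h ∈ U, h ∉ W → Q W → Q (W ⊔ k ∙ h)) : ∀ W ≤ U, Q W := by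
  classical
  have key : ∀ s : Finset (ι → k), (s : Set (ι → k)) ⊆ U → Q (Submodule.span k s) := by
    intro s
    induction s using Finset.induction with
    | empty => intro _; simpa using h0
    | insert a s _ ih =>
      intro hs
      rw [Finset.coe_insert, Set.insert_subset_iff] at hs
      rw [Finset.coe_insert, Submodule.span_insert, sup_comm]
      by_cases ha : a ∈ Submodule.span k (s : Set (ι → k))
      · rw [sup_eq_left.2 ((Submodule.span_singleton_le_iff_mem _ _).2 ha)]
        exact ih hs.2
      · exact h1 _ (Submodule.span_le.2 hs.2) _ hs.1 ha (ih hs.2)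
  intro W hW
  obtain ⟨s, rfl⟩ := IsNoetherian.noetherian W
  exact key s (Submodule.span_le.1 hW)

lemma subspace_descending {U : Submodule k (ι → k)} {Q : Submodule k (ι → k) → Prop}
    (h0 : Q U) (h1 : ∀ W ≤ U, ∀ h ∈ U, h ∉ W → Q (W ⊔ k ∙ h) → Q W) : ∀ W ≤ U, Q W := by
  intro W hW
  have := subspace_ascending (U := U) (Q := fun V => Q (W ⊔ V) → Q W) (by simp) ?_ U le_rfl
  · rw [sup_eq_right.2 hW] at this; exact this h0
  · intro V hV h hh _ ih hQ
    apply ih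
    rw [← sup_assoc] at hQ
    by_cases hm : h ∈ W ⊔ V
    · rwa [sup_eq_left.2 ((Submodule.span_singleton_le_iff_mem _ _).2 hm)] at hQ
    · exact h1 _ (sup_le hW hV) h hh hm hQ

/-- Every family of independent linear forms from `U` is a regular sequence modulo `J`. -/
def RegV (J : Ideal (MvPolynomial ι k)) (U : Submodule k (ι → k)) : Prop :=
  ∀ W ≤ U, ∀ h ∈ U, h ∉ W → Reg (J ⊔ LI W) (linForm k h)

lemma sup_LI_span (J : Ideal (MvPolynomial ι k)) (W : Submodule k (ι → k)) (h : ι → k) :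
    J ⊔ LI (W ⊔ k ∙ h) = J ⊔ LI W ⊔ Ideal.span {linForm k h} := by
  rw [LI_sup, LI_singleton, sup_assoc]

lemma mem_sup_span_vec {W : Submodule k (ι → k)} {h z : ι → k} :
    h ∈ W ⊔ k ∙ z ↔ ∃ w ∈ W, ∃ t : k, h = w + t • z := by
  rw [Submodule.mem_sup]
  constructor
  · rintro ⟨w, hw, y, hy, rfl⟩
    obtain ⟨t, rfl⟩ := Submodule.mem_span_singleton.1 hy
    exact ⟨w, hw, t, rfl⟩
  · rintro ⟨w, hw, t, rfl⟩
    exact ⟨w, hw, _, Submodule.mem_span_singleton.2 ⟨t, rfl⟩, rfl⟩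

lemma Reg.add_smul {J : Ideal (MvPolynomial ι k)} {W : Submodule k (ι → k)} {w z : ι → k}
    (hw : w ∈ W) {t : k} (ht : t ≠ 0) (hz : Reg (J ⊔ LI W) (linForm k z)) :
    Reg (J ⊔ LI W) (linForm k (w + t • z)) := by
  have h1 : Reg (J ⊔ LI W) (linForm k (t • z)) := by
    intro p hp
    apply hz
    rw [linForm_smul] at hp
    have : linForm k z * p = C t⁻¹ * (C t * linForm k z * p) := by
      rw [mul_assoc (C t), ← mul_assoc, ← C_mul, inv_mul_cancel₀ ht, C_1, one_mul]
    rw [this]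
    exact Ideal.mul_mem_left _ _ hp
  refine h1.congr ?_
  rw [linForm_add, add_sub_cancel_right]
  exact Ideal.mem_sup_right (linForm_mem_LI hw)

lemma RegV.lift {J : Ideal (MvPolynomial ι k)} (hJ : IsHom J) {U U' : Submodule k (ι → k)}
    {z : ι → k} (hU : U' ⊔ k ∙ z = U) (hz : Reg J (linForm k z))
    (hV : RegV (J ⊔ Ideal.span {linForm k z}) U') : RegV J U := by
  have hzU : z ∈ U := hU ▸ Submodule.mem_sup_right (Submodule.mem_span_singleton_self z)
  have hU'U : U' ≤ U := hU ▸ le_sup_left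
  have cA : ∀ W ≤ U, z ∈ W → ∀ h ∈ U, h ∉ W → Reg (J ⊔ LI W) (linForm k h) := by
    intro W hW hzW h hh hhW
    have e1 : W = (W ⊓ U') ⊔ k ∙ z := by
      apply le_antisymm
      · intro w hw
        obtain ⟨u, hu, t, rfl⟩ := mem_sup_span_vec.1 (hU.symm ▸ hW hw)
        refine mem_sup_span_vec.2 ⟨u, ⟨?_, hu⟩, t, rfl⟩
        have := W.sub_mem hw (W.smul_mem t hzW)
        rwa [add_sub_cancel_right] at this
      · exact sup_le inf_le_left ((Submodule.span_singleton_le_iff_mem _ _).2 hzW)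
    obtain ⟨h', hh', t, rfl⟩ := mem_sup_span_vec.1 (hU.symm ▸ hh)
    have hh'W : h' ∉ W := fun hc => hhW (W.add_mem hc (W.smul_mem t hzW))
    have e2 : J ⊔ LI W = J ⊔ Ideal.span {linForm k z} ⊔ LI (W ⊓ U') := by
      conv_lhs => rw [e1, sup_LI_span]
      rw [sup_right_comm]
    have h3 := hV (W ⊓ U') inf_le_right h' hh' (fun hc => hh'W hc.1)
    rw [← e2] at h3
    refine h3.congr ?_
    rw [linForm_add, add_sub_cancel_left]
    exact Ideal.mem_sup_right (linForm_mem_LI (W.smul_mem t hzW))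
  have cB : ∀ W ≤ U, z ∉ W → Reg (J ⊔ LI W) (linForm k z) := by
    apply subspace_ascending
    · intro _; rwa [LI_bot, sup_bot_eq]
    · intro W hW h hh hhW ih hzW
      have hzW' : z ∉ W := fun hc => hzW (Submodule.mem_sup_left hc)
      have h1 : h ∉ W ⊔ k ∙ z := by
        intro hc
        obtain ⟨w, hw, t, rfl⟩ := mem_sup_span_vec.1 hc
        by_cases ht : t = 0
        · subst ht; exact hhW (by simpa using hw)
        · apply hzW
          refine mem_sup_span_vec.2 ⟨-(t⁻¹ • w), W.neg_mem (W.smul_mem _ hw), t⁻¹, ?_⟩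
          rw [smul_add, smul_smul, inv_mul_cancel₀ ht, one_smul, neg_add_cancel_left]
      have h2 := cA (W ⊔ k ∙ z) (sup_le hW ((Submodule.span_singleton_le_iff_mem _ _).2 hzU))
        (Submodule.mem_sup_right (Submodule.mem_span_singleton_self z)) h hh h1
      rw [sup_LI_span] at h2 ⊢
      exact (ih hzW').swap h2
  intro W hW h hh hhW
  by_cases hzW : z ∈ W
  · exact cA W hW hzW h hh hhW
  by_cases hc : h ∈ W ⊔ k ∙ z
  · obtain ⟨w, hw, t, rfl⟩ := mem_sup_span_vec.1 hc
    have ht : t ≠ 0 := by rintro rfl; exact hhW (by simpa using hw)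
    exact Reg.add_smul hw ht (cB W hW hzW)
  · have h2 := cA (W ⊔ k ∙ z) (sup_le hW ((Submodule.span_singleton_le_iff_mem _ _).2 hzU))
        (Submodule.mem_sup_right (Submodule.mem_span_singleton_self z)) h hh hc
    rw [sup_LI_span] at h2
    exact Reg.of_quotient (hJ.sup (LI_isHom W)) (linForm_isHomogeneous z)
      (linForm_isHomogeneous h) (cB W hW hzW) h2

/-- Recursive form of `depth (k[X] ⧸ J) ≥ t`. -/
def Dep : ℕ → Ideal (MvPolynomial ι k) → Prop
  | 0, _ => True
  | t + 1, J => ∃ x ∈ Ideal.span (Set.range (X : ι → MvPolynomial ι k)),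
      Reg J x ∧ Dep t (J ⊔ Ideal.span {x})

lemma dep_of_list (rs : List (MvPolynomial ι k)) : ∀ (J : Ideal (MvPolynomial ι k)),
    (∀ f ∈ rs, f ∈ Ideal.span (Set.range (X : ι → MvPolynomial ι k))) →
    (∀ (i : ℕ) (h : i < rs.length), Reg (J ⊔ Ideal.ofList (rs.take i)) rs[i]) →
    Dep rs.length J := by
  induction rs with
  | nil => intro J _ _; trivial
  | cons r rs ih =>
    intro J h1 h2
    refine ⟨r, h1 r (by simp), ?_, ih _ (fun f hf => h1 f (by simp [hf])) fun i hi => ?_⟩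
    · have := h2 0 (by simp)
      rw [List.take_zero, Ideal.ofList_nil, sup_bot_eq] at this
      exact this
    · have := h2 (i + 1) (by simpa using hi)
      simpa [Ideal.ofList_cons, sup_assoc] using this

lemma dep_of_depthGE {J : Ideal (MvPolynomial ι k)} {t : ℕ} (h : depthGE k J t) : Dep t J := by
  obtain ⟨rs, rfl, h1, h2⟩ := h
  refine dep_of_list rs J h1 fun i hi p hp => ?_
  have h3 := (RingTheory.Sequence.isWeaklyRegular_map_algebraMap_iff
    (MvPolynomial ι k ⧸ J) (MvPolynomial ι k ⧸ J) rs).1 h2.toIsWeaklyRegular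
  have h4 := (RingTheory.Sequence.isWeaklyRegular_iff _ _).1 h3 i hi
  rw [isSMulRegular_quotient_iff_mem_of_smul_mem] at h4
  have e : ∀ p : MvPolynomial ι k, Ideal.Quotient.mk J p ∈
      (Ideal.ofList (rs.take i) • ⊤ : Submodule (MvPolynomial ι k) (MvPolynomial ι k ⧸ J)) ↔
      p ∈ J ⊔ Ideal.ofList (rs.take i) := by
    intro p
    rw [Ideal.smul_top_eq_map, Submodule.restrictScalars_mem, sup_comm]
    exact Ideal.mem_quotient_iff_mem_sup
  rw [← e] at hp ⊢
  exact h4 _ hp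

/-- Every variable is nilpotent modulo `J`. -/
def NilX (J : Ideal (MvPolynomial ι k)) : Prop := ∀ i : ι, ∃ N : ℕ, X i ^ N ∈ J

lemma NilX.mono {I J : Ideal (MvPolynomial ι k)} (h : NilX I) (hIJ : I ≤ J) : NilX J := by
  intro i
  obtain ⟨N, hN⟩ := h i
  exact ⟨N, hIJ hN⟩

lemma exists_avoid {E : Type*} [AddCommGroup E] [Module k E] [Infinite k] (U : Submodule k E)
    (F : Finset (Submodule k E)) (h : ∀ P ∈ F, ¬ U ≤ P) : ∃ z ∈ U, ∀ P ∈ F, z ∉ P := by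
  classical
  have := Subspace.biUnion_ne_univ_of_top_notMem (k := k) (E := U)
    (s := F.image fun P => P.comap U.subtype) (by
      simp only [Finset.mem_image, not_exists, not_and]
      intro P hP e
      exact h P hP (Submodule.comap_subtype_eq_top.1 e))
  obtain ⟨z, hz⟩ := (Set.ne_univ_iff_exists_notMem _).1 this
  refine ⟨z, z.2, fun P hP hc => hz ?_⟩
  simp only [Finset.mem_image, Set.mem_iUnion]
  exact ⟨_, ⟨P, hP, rfl⟩, hc⟩

/-- The linear map sending a coefficient vector to the corresponding linear form. -/
def linFormₗ : (ι → k) →ₗ[k] MvPolynomial ι k where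
  toFun := linForm k
  map_add' := linForm_add
  map_smul' := fun t a => by rw [linForm_smul, RingHom.id_apply, MvPolynomial.smul_eq_C_mul]

lemma dep_avoid [Infinite k] (U : Submodule k (ι → k)) : ∀ (t : ℕ) (J : Ideal (MvPolynomial ι k)),
    Dep (t + 1) J → NilX (J ⊔ LI U) →
    ∃ F : Finset (Submodule k (ι → k)), (∀ P ∈ F, ¬ U ≤ P) ∧
      ∀ z ∈ U, (∀ P ∈ F, z ∉ P) →
        Reg J (linForm k z) ∧ Dep t (J ⊔ Ideal.span {linForm k z}) := by
  classical
  have base : ∀ (J : Ideal (MvPolynomial ι k)) (x : MvPolynomial ι k),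
      x ∈ Ideal.span (Set.range (X : ι → MvPolynomial ι k)) → Reg J x → NilX (J ⊔ LI U) →
      ∃ F : Finset (Submodule k (ι → k)), (∀ P ∈ F, ¬ U ≤ P) ∧
      ∀ z ∈ U, (∀ P ∈ F, z ∉ P) → Reg J (linForm k z) := by
    intro J x hx hxr hnil
    have hfin := associatedPrimes.finite (MvPolynomial ι k) (MvPolynomial ι k ⧸ J)
    have hun := biUnion_associatedPrimes_eq_zero_divisors (MvPolynomial ι k)
      (MvPolynomial ι k ⧸ J)
    refine ⟨hfin.toFinset.image fun P => (P.restrictScalars k).comap linFormₗ, ?_, ?_⟩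
    · intro P' hP' hU
      obtain ⟨P, hP, rfl⟩ := Finset.mem_image.1 hP'
      have hP : IsAssociatedPrime P (MvPolynomial ι k ⧸ J) := hfin.mem_toFinset.1 hP
      have hJP : J ≤ P := by
        have := hP.annihilator_le
        rwa [Submodule.annihilator_top, Ideal.annihilator_quotient] at this
      have hLP : LI U ≤ P := by
        rw [LI, Ideal.span_le]
        rintro _ ⟨h, hh, rfl⟩
        exact hU hh
      have hprime := hP.isPrime
      have hXP : ∀ i, X i ∈ P := by
        intro i
        obtain ⟨N, hN⟩ := hnil i
        exact hprime.mem_of_pow_mem N ((sup_le hJP hLP) hN)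
      have hxP : x ∈ P := by
        refine (Ideal.span_le.2 ?_) hx
        rintro _ ⟨i, rfl⟩
        exact hXP i
      have : x ∈ {r : MvPolynomial ι k | ∃ y : MvPolynomial ι k ⧸ J, y ≠ 0 ∧ r • y = 0} := by
        rw [← hun]
        simp only [Set.mem_iUnion]
        exact ⟨P, hP, hxP⟩
      obtain ⟨y, hy, hxy⟩ := this
      obtain ⟨y, rfl⟩ := Ideal.Quotient.mk_surjective y
      apply hy
      rw [Ideal.Quotient.eq_zero_iff_mem]
      apply hxr
      rw [← Ideal.Quotient.eq_zero_iff_mem]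
      exact hxy
    · intro z _ hz p hp
      by_contra hpJ
      have : linForm k z ∈
          {r : MvPolynomial ι k | ∃ y : MvPolynomial ι k ⧸ J, y ≠ 0 ∧ r • y = 0} := by
        refine ⟨Ideal.Quotient.mk J p, fun h => hpJ (Ideal.Quotient.eq_zero_iff_mem.1 h), ?_⟩
        exact Ideal.Quotient.eq_zero_iff_mem.2 hp
      rw [← hun] at this
      simp only [Set.mem_iUnion] at this
      obtain ⟨P, hP, hzP⟩ := this
      exact hz _ (Finset.mem_image.2 ⟨P, by simpa using hP, rfl⟩) hzP
  intro t
  induction t with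
  | zero =>
    rintro J ⟨x, hx, hxr, -⟩ hnil
    obtain ⟨F, h1, h2⟩ := base J x hx hxr hnil
    exact ⟨F, h1, fun z hz hF => ⟨h2 z hz hF, trivial⟩⟩
  | succ t ih =>
    rintro J ⟨x, hx, hxr, hdep⟩ hnil
    obtain ⟨F, h1, h2⟩ := base J x hx hxr hnil
    obtain ⟨F', h1', h2'⟩ := ih (J ⊔ Ideal.span {x}) hdep
      (hnil.mono (sup_le_sup_right le_sup_left _))
    refine ⟨F ∪ F', fun P hP => ?_, fun z hz hF => ?_⟩
    · rcases Finset.mem_union.1 hP with h | h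
      exacts [h1 P h, h1' P h]
    · have hz1 := h2 z hz fun P hP => hF P (Finset.mem_union_left _ hP)
      have hz2 := h2' z hz fun P hP => hF P (Finset.mem_union_right _ hP)
      refine ⟨hz1, x, hx, hxr.swap hz2.1, ?_⟩
      rw [sup_right_comm]
      exact hz2.2

lemma span_linForm_isHom (z : ι → k) : IsHom (Ideal.span {linForm k z}) := by
  rw [← LI_singleton]; exact LI_isHom _

lemma regV_of_dep [Infinite k] : ∀ (t : ℕ) (J : Ideal (MvPolynomial ι k))
    (U : Submodule k (ι → k)), IsHom J → Module.finrank k U ≤ t → NilX (J ⊔ LI U) →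
    Dep t J → RegV J U := by
  intro t
  induction t with
  | zero =>
    intro J U _ hU _ _ W _ h hh hhW
    have : U = ⊥ := Submodule.finrank_eq_zero.1 (by omega)
    subst this
    have h0 : h = 0 := by simpa using hh
    exact absurd (h0 ▸ W.zero_mem) hhW
  | succ t ih =>
    intro J U hJ hU hnil hdep
    obtain ⟨F, h1, h2⟩ := dep_avoid U t J hdep hnil
    obtain ⟨z, hz, hzF⟩ := exists_avoid U F h1
    obtain ⟨hz1, hz2⟩ := h2 z hz hzF
    by_cases hz0 : z = 0
    · intro W _ h _ _ p _
      refine Ideal.mem_sup_left (hz1 p ?_)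
      have : linForm k z = 0 := by rw [hz0]; exact linFormₗ.map_zero
      rw [this, zero_mul]; exact J.zero_mem
    obtain ⟨V, hV⟩ := Submodule.exists_isCompl (k ∙ z)
    have hzU : k ∙ z ≤ U := (Submodule.span_singleton_le_iff_mem _ _).2 hz
    have hsup : (V ⊓ U) ⊔ k ∙ z = U := by
      rw [inf_comm, inf_sup_assoc_of_le V hzU, sup_comm, hV.sup_eq_top, inf_top_eq]
    refine RegV.lift hJ hsup hz1 (ih _ _ (hJ.sup (span_linForm_isHom z)) ?_ ?_ hz2)
    · have hlt : V ⊓ U < U := by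
        refine lt_of_le_of_ne inf_le_right fun he => ?_
        have hzV : z ∈ V := (he.symm ▸ hz : z ∈ V ⊓ U).1
        exact hz0 ((Submodule.disjoint_def.1 hV.disjoint) z (Submodule.mem_span_singleton_self z) hzV)
      have := Submodule.finrank_lt_finrank_of_lt hlt
      omega
    · have : J ⊔ Ideal.span {linForm k z} ⊔ LI (V ⊓ U) = J ⊔ LI U := by
        conv_rhs => rw [← hsup, sup_LI_span]
        rw [sup_right_comm]
      rwa [this]

lemma nilX_of_artinian {J : Ideal (MvPolynomial ι k)} (hJ : IsHom J)
    (h : IsArtinianRing (MvPolynomial ι k ⧸ J)) : NilX J := by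
  intro i
  obtain ⟨N, y, hy⟩ := IsArtinian.exists_pow_succ_smul_dvd
    (Ideal.Quotient.mk J (X i)) (1 : MvPolynomial ι k ⧸ J)
  obtain ⟨y, rfl⟩ := Ideal.Quotient.mk_surjective y
  refine ⟨N, ?_⟩
  have h1 : X i ^ N.succ * y - X i ^ N ∈ J := by
    rw [← Ideal.Quotient.eq_zero_iff_mem]
    simpa [sub_eq_zero] using hy
  have h2 := hJ _ h1 N
  rw [map_sub, hc_mul_lt (isHomogeneous_X_pow i _) _ (Nat.lt_succ_self N),
    hc_of_mem (isHomogeneous_X_pow i _), zero_sub] at h2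
  simpa using J.neg_mem h2

/-- The socle of `k[X] ⧸ J` is at most one-dimensional. -/
def Gor1 (J : Ideal (MvPolynomial ι k)) : Prop :=
  ∀ u v, (∀ j, X j * u ∈ J) → (∀ j, X j * v ∈ J) → u ∉ J → ∃ a : k, v - C a * u ∈ J

lemma mem_socle {J : Ideal (MvPolynomial ι k)} {u : MvPolynomial ι k} :
    Ideal.Quotient.mk J u ∈ socle k J ↔ ∀ j, X j * u ∈ J := by
  simp only [socle, Submodule.mem_iInf, LinearMap.mem_ker, LinearMap.mulLeft_apply, ← map_mul,
    Ideal.Quotient.eq_zero_iff_mem]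

lemma gor1_of_artGor {J : Ideal (MvPolynomial ι k)} (h : artGor k J) : Gor1 J := by
  intro u v hu hv huJ
  have hne : (⟨_, mem_socle.2 hu⟩ : socle k J) ≠ 0 := by
    intro hc
    exact huJ (Ideal.Quotient.eq_zero_iff_mem.1 (congrArg Subtype.val hc))
  obtain ⟨a, ha⟩ := (finrank_eq_one_iff_of_nonzero' _ hne).1 h.2 ⟨_, mem_socle.2 hv⟩
  have ha' := congrArg (socle k J).subtype ha
  change a • Ideal.Quotient.mk J u = Ideal.Quotient.mk J v at ha'
  refine ⟨a, ?_⟩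
  rw [← Ideal.Quotient.eq_zero_iff_mem, map_sub, ← MvPolynomial.smul_eq_C_mul, ← ha', sub_eq_zero]
  exact ((Ideal.Quotient.mkₐ k J).toLinearMap.map_smul a u).symm

lemma NilX.pow_le {J : Ideal (MvPolynomial ι k)} (h : NilX J) :
    ∃ N, Ideal.span (Set.range (X : ι → MvPolynomial ι k)) ^ N ≤ J := by
  refine Ideal.exists_pow_le_of_le_radical_of_fg ?_ ?_
  · rw [Ideal.span_le]
    rintro _ ⟨i, rfl⟩
    exact h i
  · exact IsNoetherian.noetherian _

lemma X_mem_irrelevant (j : ι) :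
    (X j : MvPolynomial ι k) ∈ Ideal.span (Set.range (X : ι → MvPolynomial ι k)) :=
  Ideal.subset_span ⟨j, rfl⟩

lemma exists_socle {E J : Ideal (MvPolynomial ι k)} (hJ : NilX J) (hE : ¬ E ≤ J) :
    ∃ u ∈ E, u ∉ J ∧ ∀ j, X j * u ∈ J := by
  obtain ⟨N, hN⟩ := hJ.pow_le
  have key : ∀ t, Ideal.span (Set.range (X : ι → MvPolynomial ι k)) ^ t * E ≤ J →
      ∃ u ∈ E, u ∉ J ∧ ∀ j, X j * u ∈ J := by
    intro t
    induction t with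
    | zero =>
      intro h
      rw [pow_zero, one_mul] at h
      exact absurd h hE
    | succ t ih =>
      intro h
      by_cases h' : Ideal.span (Set.range (X : ι → MvPolynomial ι k)) ^ t * E ≤ J
      · exact ih h'
      · obtain ⟨u, hu, huJ⟩ := SetLike.not_le_iff_exists.1 h'
        have huE : u ∈ E := by
          have hle : Ideal.span (Set.range (X : ι → MvPolynomial ι k)) ^ t * E ≤ E :=
            Ideal.mul_le_right
          exact hle hu
        refine ⟨u, huE, huJ, fun j => h ?_⟩
        rw [pow_succ', mul_assoc]
        exact Ideal.mul_mem_mul (X_mem_irrelevant j) hu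
  exact key N ((Ideal.mul_le_left).trans hN)

lemma exists_homogeneous_socle {J : Ideal (MvPolynomial ι k)} (hJ : NilX J)
    {u : MvPolynomial ι k} (hu : u ∉ J) :
    ∃ (t : ℕ) (r : MvPolynomial ι k), r.IsHomogeneous t ∧ r * u ∉ J ∧ ∀ j, X j * (r * u) ∈ J := by
  obtain ⟨N, hN⟩ := hJ.pow_le
  have key : ∀ s (u : MvPolynomial ι k), u ∉ J →
      (∀ r ∈ Ideal.span (Set.range (X : ι → MvPolynomial ι k)) ^ s, r * u ∈ J) →
      ∃ (t : ℕ) (r : MvPolynomial ι k), r.IsHomogeneous t ∧ r * u ∉ J ∧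
        ∀ j, X j * (r * u) ∈ J := by
    intro s
    induction s with
    | zero =>
      intro u hu h
      exact absurd (by simpa using h 1 (by simp)) hu
    | succ s ih =>
      intro u hu h
      by_cases hall : ∀ j, X j * u ∈ J
      · exact ⟨0, 1, isHomogeneous_one _ _, by simpa using hu, by simpa using hall⟩
      · push Not at hall
        obtain ⟨j, hj⟩ := hall
        obtain ⟨t, r, h1, h2, h3⟩ := ih (X j * u) hj fun r hr => by
          rw [← mul_assoc]
          refine h _ ?_
          rw [pow_succ]
          exact Ideal.mul_mem_mul hr (X_mem_irrelevant j)
        refine ⟨t + 1, r * X j, h1.mul (isHomogeneous_X k j), ?_, ?_⟩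
        · rwa [mul_assoc]
        · simpa only [mul_assoc] using h3
  exact key N u hu fun r hr => J.mul_mem_right _ (hN hr)

/-- Poincaré duality with socle degree `e` for the graded algebra `k[X] ⧸ J`. -/
def PD (J : Ideal (MvPolynomial ι k)) (e : ℕ) : Prop :=
  (∀ (m : ℕ) (u : MvPolynomial ι k), u.IsHomogeneous m → u ∉ J →
    ∃ (t : ℕ) (r : MvPolynomial ι k), m + t = e ∧ r.IsHomogeneous t ∧ r * u ∉ J) ∧
  (∀ u v : MvPolynomial ι k, u.IsHomogeneous e → v.IsHomogeneous e → u ∉ J →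
    ∃ a : k, v - C a * u ∈ J)

lemma PD.mem_of_gt {J : Ideal (MvPolynomial ι k)} {e : ℕ} (h : PD J e) {m : ℕ} (hm : e < m)
    {u : MvPolynomial ι k} (hu : u.IsHomogeneous m) : u ∈ J := by
  by_contra hc
  obtain ⟨t, r, h1, -⟩ := h.1 m u hu hc
  omega

lemma exists_PD {J : Ideal (MvPolynomial ι k)} (hJ : IsHom J) (hnil : NilX J) (hg : Gor1 J)
    (hne : J ≠ ⊤) : ∃ e, PD J e := by
  obtain ⟨e, w, hw, hwJ, hws⟩ := exists_homogeneous_socle hnil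
    (u := 1) (fun h => hne ((Ideal.eq_top_iff_one J).2 h))
  rw [mul_one] at hwJ hws
  have h1 : ∀ (m : ℕ) (u : MvPolynomial ι k), u.IsHomogeneous m → u ∉ J →
      ∃ (t : ℕ) (r : MvPolynomial ι k), m + t = e ∧ r.IsHomogeneous t ∧ r * u ∉ J := by
    intro m u hu huJ
    obtain ⟨t, r, hr, hru, hs⟩ := exists_homogeneous_socle hnil huJ
    refine ⟨t, r, ?_, hr, hru⟩
    by_contra hne
    obtain ⟨a, ha⟩ := hg w (r * u) hws hs hwJ
    have := hJ _ ha (t + m)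
    rw [map_sub, homogeneousComponent_C_mul, hc_of_mem (hr.mul hu),
      hc_of_mem_ne hw (by omega), mul_zero, sub_zero] at this
    exact hru this
  refine ⟨e, h1, fun u v hu hv huJ => hg u v ?_ ?_ huJ⟩
  all_goals
    intro j
    by_contra hc
    obtain ⟨t, r, h2, -⟩ := h1 (1 + e) _ ((isHomogeneous_X k j).mul ‹_›) hc
    omega

@[ext] lemma SC.ext' {D E : SC n} (h : ∀ ρ, ρ ∈ D.faces ↔ ρ ∈ E.faces) : D = E := by
  cases D; cases E
  congr
  exact Finset.ext h

/-- The star of `σ`: the faces `ρ` such that `σ ∪ ρ` is a face. -/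
def star (σ : Finset (Fin n)) (D : SC n) : SC n where
  faces := D.faces.filter fun ρ => σ ∪ ρ ∈ D.faces
  down_closed := by
    intro s hs t hts
    rw [Finset.mem_filter] at hs ⊢
    exact ⟨D.down_closed s hs.1 t hts, D.down_closed _ hs.2 _ (Finset.union_subset_union_right hts)⟩

lemma mem_star {σ ρ : Finset (Fin n)} {D : SC n} : ρ ∈ (star σ D).faces ↔ σ ∪ ρ ∈ D.faces := by
  rw [star, Finset.mem_filter, and_iff_right_iff_imp]
  exact fun h => D.down_closed _ h _ Finset.subset_union_right

lemma star_star (σ τ : Finset (Fin n)) (D : SC n) : star τ (star σ D) = star (σ ∪ τ) D := by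
  ext ρ
  rw [mem_star, mem_star, mem_star, Finset.union_assoc]

lemma xFace_eq_monomial (s : Finset (Fin n)) :
    (∏ i ∈ s, X i : MvPolynomial (Fin n) k) = monomial (∑ i ∈ s, Finsupp.single i 1) 1 := by
  rw [monomial_sum_one]; rfl

lemma sum_single_le_iff (s : Finset (Fin n)) (m : Fin n →₀ ℕ) :
    ∑ i ∈ s, Finsupp.single i 1 ≤ m ↔ s ⊆ m.support := by
  have e : ∀ j, (∑ i ∈ s, Finsupp.single i 1 : Fin n →₀ ℕ) j = if j ∈ s then 1 else 0 := by
    intro j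
    rw [Finsupp.finsetSum_apply]
    simp [Finsupp.single_apply]
  rw [Finsupp.le_def]
  constructor
  · intro h j hj
    have := h j
    rw [e, if_pos hj] at this
    rw [Finsupp.mem_support_iff]; omega
  · intro h j
    rw [e]
    split_ifs with hj
    · have := Finsupp.mem_support_iff.1 (h hj); omega
    · omega

lemma mem_srIdeal {D : SC n} {p : MvPolynomial (Fin n) k} :
    p ∈ srIdeal k D ↔ ∀ m ∈ p.support, m.support ∉ D.faces := by
  have e : {p : MvPolynomial (Fin n) k | ∃ s : Finset (Fin n), s ∉ D.faces ∧ p = ∏ i ∈ s, X i} =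
      (fun m => monomial m (1 : k)) ''
        ((fun s : Finset (Fin n) => ∑ i ∈ s, Finsupp.single i 1) '' {s | s ∉ D.faces}) := by
    ext p
    constructor
    · rintro ⟨s, hs, rfl⟩
      exact ⟨_, ⟨s, hs, rfl⟩, (xFace_eq_monomial s).symm⟩
    · rintro ⟨_, ⟨s, hs, rfl⟩, rfl⟩
      exact ⟨s, hs, (xFace_eq_monomial s).symm⟩
  rw [srIdeal, e, mem_ideal_span_monomial_image]
  refine forall₂_congr fun m _ => ?_
  constructor
  · rintro ⟨_, ⟨s, hs, rfl⟩, hsm⟩ hc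
    exact hs (D.down_closed _ hc _ ((sum_single_le_iff s m).1 hsm))
  · intro h
    exact ⟨_, ⟨m.support, h, rfl⟩, (sum_single_le_iff _ m).2 le_rfl⟩

lemma srIdeal_isHom (D : SC n) : IsHom (srIdeal k D) := by
  refine isHom_span ?_
  rintro _ ⟨s, -, rfl⟩
  exact ⟨_, IsHomogeneous.prod s _ (fun _ => 1) fun i _ => isHomogeneous_X k i⟩

lemma X_mul_mem_srIdeal {D : SC n} {i : Fin n} {p : MvPolynomial (Fin n) k} :
    X i * p ∈ srIdeal k D ↔ p ∈ srIdeal k (star {i} D) := by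
  rw [mem_srIdeal, mem_srIdeal, support_X_mul]
  simp only [Finset.mem_map, forall_exists_index, and_imp, forall_apply_eq_imp_iff₂,
    addLeftEmbedding_apply, mem_star]
  refine forall₂_congr fun m _ => ?_
  have : (Finsupp.single i 1 + m).support = {i} ∪ m.support := by
    ext j
    by_cases h : j = i
    · subst h; simp
    · simp [h]
  rw [this]

lemma xFace_mul_mem_srIdeal {σ : Finset (Fin n)} : ∀ {D : SC n} {p : MvPolynomial (Fin n) k},
    xFace k σ * p ∈ srIdeal k D ↔ p ∈ srIdeal k (star σ D) := by
  induction σ using Finset.induction with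
  | empty =>
    intro D p
    have : star ∅ D = D := by ext ρ; rw [mem_star, Finset.empty_union]
    rw [this, xFace, Finset.prod_empty, one_mul]
  | insert i σ hi ih =>
    intro D p
    rw [xFace, Finset.prod_insert hi, mul_assoc, X_mul_mem_srIdeal]
    rw [show (∏ i ∈ σ, X i : MvPolynomial (Fin n) k) = xFace k σ from rfl, ih, star_star,
      Finset.insert_eq]

lemma linkIdeal_eq (D : SC n) (σ : Finset (Fin n)) :
    linkIdeal k D σ = srIdeal k (star σ D) := by
  ext p
  rw [← xFace_mul_mem_srIdeal, linkIdeal, Submodule.mem_colon]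
  constructor
  · intro h
    rw [mul_comm]
    exact h _ (Ideal.mem_span_singleton_self _)
  · intro h s hs
    obtain ⟨a, rfl⟩ := Ideal.mem_span_singleton'.1 hs
    have : p • (a * xFace k σ) = a * (xFace k σ * p) := by rw [smul_eq_mul]; ring
    rw [this]
    exact Ideal.mul_mem_left _ _ h

lemma xFace_mem_srIdeal {D : SC n} {s : Finset (Fin n)} (hs : s ∉ D.faces) :
    (∏ i ∈ s, X i : MvPolynomial (Fin n) k) ∈ srIdeal k D := Ideal.subset_span ⟨s, hs, rfl⟩

lemma xFace_notMem_srIdeal {D : SC n} {s : Finset (Fin n)} (hs : s ∈ D.faces) :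
    xFace k s ∉ srIdeal k D := by
  intro h
  rw [xFace, xFace_eq_monomial] at h
  refine mem_srIdeal.1 h (∑ i ∈ s, Finsupp.single i 1) (by simp) ?_
  convert hs
  apply subset_antisymm
  · intro j hj
    by_contra hjs
    rw [Finsupp.mem_support_iff, Finsupp.finsetSum_apply] at hj
    apply hj
    refine Finset.sum_eq_zero fun i hi => ?_
    rw [Finsupp.single_apply, if_neg]
    rintro rfl; exact hjs hi
  · exact (sum_single_le_iff s _).1 le_rfl

lemma srIdeal_le_star (D : SC n) (σ : Finset (Fin n)) : srIdeal k D ≤ srIdeal k (star σ D) := by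
  intro p hp
  rw [← xFace_mul_mem_srIdeal]
  exact Ideal.mul_mem_left _ _ hp

lemma X_mul_mem {D : SC n} {i : Fin n} {L : Ideal (MvPolynomial (Fin n) k)}
    {p : MvPolynomial (Fin n) k} (hp : p ∈ srIdeal k (star {i} D) ⊔ L) :
    X i * p ∈ srIdeal k D ⊔ L := by
  obtain ⟨a, ha, b, hb, rfl⟩ := Submodule.mem_sup.1 hp
  rw [mul_add]
  exact Submodule.add_mem_sup (X_mul_mem_srIdeal.2 ha) (Ideal.mul_mem_left _ _ hb)

lemma eval_linForm (u p : ι → k) : eval p (linForm k u) = ∑ i, u i * p i := by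
  simp [linForm]

/-- A point supported on a face at which all forms of `U` vanish kills `I_D + (U)`. -/
lemma eval_eq_zero_of_mem {D : SC n} {U : Submodule k (Fin n → k)} {F : Finset (Fin n)}
    (hF : F ∈ D.faces) {p : Fin n → k} (hp : ∀ i ∉ F, p i = 0)
    (hU : ∀ u ∈ U, ∑ i, u i * p i = 0) {f : MvPolynomial (Fin n) k}
    (hf : f ∈ srIdeal k D ⊔ LI U) : eval p f = 0 := by
  have : srIdeal k D ⊔ LI U ≤ RingHom.ker (eval p) := by
    refine sup_le (Ideal.span_le.2 ?_) (Ideal.span_le.2 ?_)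
    · rintro _ ⟨s, hs, rfl⟩
      have : ¬ s ⊆ F := fun h => hs (D.down_closed _ hF _ h)
      obtain ⟨i, his, hiF⟩ := Finset.not_subset.1 this
      change eval p _ = 0
      rw [map_prod]
      exact Finset.prod_eq_zero his (by rw [eval_X, hp i hiF])
    · rintro _ ⟨u, hu, rfl⟩
      change eval p _ = 0
      rw [eval_linForm, hU u hu]
  exact this hf

lemma point_eq_zero {D : SC n} {U : Submodule k (Fin n → k)}
    (hnil : NilX (srIdeal k D ⊔ LI U)) {F : Finset (Fin n)}
    (hF : F ∈ D.faces) {p : Fin n → k} (hp : ∀ i ∉ F, p i = 0)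
    (hU : ∀ u ∈ U, ∑ i, u i * p i = 0) : p = 0 := by
  funext i
  obtain ⟨N, hN⟩ := hnil i
  have := eval_eq_zero_of_mem hF hp hU hN
  rw [map_pow, eval_X] at this
  exact eq_zero_of_pow_eq_zero this

lemma one_notMem {D : SC n} (U : Submodule k (Fin n → k)) (hD : ∅ ∈ D.faces) :
    (1 : MvPolynomial (Fin n) k) ∉ srIdeal k D ⊔ LI U := by
  intro h
  have := eval_eq_zero_of_mem (p := 0) hD (by simp) (by simp) h
  simp at this

/-- Polynomials with constant coefficient in the first ideal and all coefficients in the second. -/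
def coeffIdeal {R : Type*} [CommRing R] (J J' : Ideal R) : Ideal (Polynomial R) where
  carrier := {P | P.coeff 0 ∈ J ∧ ∀ j, P.coeff j ∈ J'}
  zero_mem' := by simp
  add_mem' := by
    rintro a b ⟨h1, h2⟩ ⟨h3, h4⟩
    exact ⟨by rw [Polynomial.coeff_add]; exact J.add_mem h1 h3, fun j => by
      rw [Polynomial.coeff_add]; exact J'.add_mem (h2 j) (h4 j)⟩
  smul_mem' := by
    rintro c P ⟨h1, h2⟩
    refine ⟨?_, fun j => ?_⟩
    · rw [smul_eq_mul, Polynomial.mul_coeff_zero]; exact J.mul_mem_left _ h1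
    · rw [smul_eq_mul, Polynomial.coeff_mul]
      exact Ideal.sum_mem _ fun x _ => J'.mul_mem_left _ (h2 _)

lemma mem_coeffIdeal {R : Type*} [CommRing R] {J J' : Ideal R} {P : Polynomial R} :
    P ∈ coeffIdeal J J' ↔ P.coeff 0 ∈ J ∧ ∀ j, P.coeff j ∈ J' := Iff.rfl

lemma C_mem_coeffIdeal {R : Type*} [CommRing R] {J J' : Ideal R} {r : R} (h : r ∈ J)
    (h' : r ∈ J') : Polynomial.C r ∈ coeffIdeal J J' := by
  refine ⟨by simpa using h, fun j => ?_⟩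
  rw [Polynomial.coeff_C]
  split_ifs
  exacts [h', J'.zero_mem]

lemma X_mul_C_mem_coeffIdeal {R : Type*} [CommRing R] {J J' : Ideal R} {r : R}
    (h' : r ∈ J') : Polynomial.X * Polynomial.C r ∈ coeffIdeal J J' := by
  refine ⟨by simp, fun j => ?_⟩
  rw [mul_comm, Polynomial.coeff_C_mul_X]
  split_ifs
  exacts [h', J'.zero_mem]

/-- Regard a polynomial as a univariate polynomial in `X i`. -/
def inVar (i : Fin n) :
    MvPolynomial (Fin n) k →ₐ[k] Polynomial (MvPolynomial (Fin n) k) :=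
  aeval fun j => if j = i then Polynomial.X else Polynomial.C (X j)

lemma inVar_X_self (i : Fin n) : inVar (k := k) i (X i) = Polynomial.X := by simp [inVar]

lemma inVar_X_ne {i j : Fin n} (h : j ≠ i) : inVar (k := k) i (X j) = Polynomial.C (X j) := by
  simp [inVar, h]

lemma eval_inVar (i : Fin n) (p : MvPolynomial (Fin n) k) :
    (inVar i p).eval (X i) = p := by
  induction p using MvPolynomial.induction_on with
  | C a =>
    have : inVar i (C a : MvPolynomial (Fin n) k) = Polynomial.C (C a) := by
      simp [inVar, Polynomial.C_eq_algebraMap]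
    rw [this, Polynomial.eval_C]
  | add p q hp hq => rw [map_add, Polynomial.eval_add, hp, hq]
  | mul_X p j hp =>
    rw [map_mul, Polynomial.eval_mul, hp]
    by_cases h : j = i
    · subst h; rw [inVar_X_self, Polynomial.eval_X]
    · rw [inVar_X_ne h, Polynomial.eval_C]

lemma inVar_C (i : Fin n) (a : k) :
    inVar i (C a : MvPolynomial (Fin n) k) = Polynomial.C (C a) := by
  simp [inVar, Polynomial.C_eq_algebraMap]

lemma inVar_linForm {i : Fin n} {u : Fin n → k} (hu : u i = 0) :
    inVar i (linForm k u) = Polynomial.C (linForm k u) := by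
  rw [linForm, map_sum, map_sum]
  refine Finset.sum_congr rfl fun j _ => ?_
  by_cases h : j = i
  · subst h; simp [hu]
  · rw [map_mul, inVar_C, inVar_X_ne h, map_mul]

lemma inVar_mem {D : SC n} {i : Fin n} {U : Submodule k (Fin n → k)} (hU : ∀ u ∈ U, u i = 0)
    {p : MvPolynomial (Fin n) k} (hp : p ∈ srIdeal k D ⊔ LI U) :
    inVar i p ∈ coeffIdeal (srIdeal k D ⊔ LI U) (srIdeal k (star {i} D) ⊔ LI U) := by
  have : srIdeal k D ⊔ LI U ≤ Ideal.comap (inVar i)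
      (coeffIdeal (srIdeal k D ⊔ LI U) (srIdeal k (star {i} D) ⊔ LI U)) := by
    refine sup_le (Ideal.span_le.2 ?_) (Ideal.span_le.2 ?_)
    · rintro _ ⟨s, hs, rfl⟩
      have e : ∀ t : Finset (Fin n), i ∉ t → inVar (k := k) i (∏ j ∈ t, X j) =
          Polynomial.C (∏ j ∈ t, X j) := by
        intro t ht
        rw [map_prod, map_prod]
        refine Finset.prod_congr rfl fun j hj => inVar_X_ne ?_
        rintro rfl; exact ht hj
      rw [SetLike.mem_coe, Ideal.mem_comap]
      by_cases hi : i ∈ s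
      · rw [← Finset.mul_prod_erase _ _ hi, map_mul, inVar_X_self, e _ (Finset.notMem_erase i s)]
        refine X_mul_C_mem_coeffIdeal (Ideal.mem_sup_left (xFace_mem_srIdeal ?_))
        rwa [mem_star, ← Finset.insert_eq, Finset.insert_erase hi]
      · rw [e s hi]
        exact C_mem_coeffIdeal (Ideal.mem_sup_left (xFace_mem_srIdeal hs))
          (Ideal.mem_sup_left (srIdeal_le_star D _ (xFace_mem_srIdeal hs)))
    · rintro _ ⟨u, hu, rfl⟩
      rw [SetLike.mem_coe, Ideal.mem_comap]
      rw [inVar_linForm (hU u hu)]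
      exact C_mem_coeffIdeal (Ideal.mem_sup_right (linForm_mem_LI hu))
          (Ideal.mem_sup_right (linForm_mem_LI hu))
  exact this hp

lemma eval_mem_of_coeff_mem {R : Type*} [CommRing R] {J : Ideal R} {P : Polynomial R} (x : R)
    (h : ∀ j, P.coeff j ∈ J) : P.eval x ∈ J := by
  rw [Polynomial.eval_eq_sum_range]
  exact Ideal.sum_mem _ fun j _ => J.mul_mem_right _ (h j)

lemma inVar_eval {i : Fin n} {g : MvPolynomial (Fin n) k} (hg : inVar i g = Polynomial.C g)
    (p : MvPolynomial (Fin n) k) :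
    inVar i ((inVar i p).eval (-g)) = Polynomial.C ((inVar i p).eval (-g)) := by
  induction p using MvPolynomial.induction_on with
  | C a => rw [inVar_C, Polynomial.eval_C, inVar_C]
  | add p q hp hq => simp only [map_add, Polynomial.eval_add, hp, hq]
  | mul_X p j hp =>
    rw [map_mul, Polynomial.eval_mul, map_mul, hp, map_mul]
    by_cases h : j = i
    · subst h; rw [inVar_X_self, Polynomial.eval_X, map_neg, hg, map_neg]
    · rw [inVar_X_ne h, Polynomial.eval_C, inVar_X_ne h]

lemma coeff_mem_of_recurrence {R : Type*} [CommRing R] {J : Ideal R} {P : Polynomial R} {g : R}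
    (h : ∀ j, P.coeff (j + 1) + g * P.coeff (j + 2) ∈ J) : ∀ j, P.coeff (j + 1) ∈ J := by
  have key : ∀ s j, P.natDegree < j + 1 + s → P.coeff (j + 1) ∈ J := by
    intro s
    induction s with
    | zero =>
      intro j hj
      rw [Polynomial.coeff_eq_zero_of_natDegree_lt (by omega)]
      exact J.zero_mem
    | succ s ih =>
      intro j hj
      have := J.sub_mem (h j) (J.mul_mem_left g (ih (j + 1) (by omega)))
      rwa [add_sub_cancel_right] at this
  exact fun j => key (P.natDegree + 1) j (by omega)

lemma colon_of_reduction {i : Fin n} {g : MvPolynomial (Fin n) k}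
    {J J' : Ideal (MvPolynomial (Fin n) k)} (hle : J ≤ J') (hX : ∀ p ∈ J', X i * p ∈ J)
    (hg : inVar i g = Polynomial.C g) (h1 : ∀ p ∈ J, inVar i p ∈ coeffIdeal J J')
    (h2 : ∀ p ∈ J', ∀ j, (inVar i p).coeff j ∈ J') (hreg : Reg J (X i + g))
    (hgor : Gor1 (J ⊔ Ideal.span {X i + g})) (hnil : NilX (J ⊔ Ideal.span {X i + g}))
    (hne : ¬ J' ≤ J ⊔ Ideal.span {X i + g}) {p : MvPolynomial (Fin n) k}
    (hp : X i * p ∈ J ⊔ Ideal.span {X i + g}) : p ∈ J' ⊔ Ideal.span {X i + g} := by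
  by_contra hpn
  have hle' : J ⊔ Ideal.span {X i + g} ≤ J' ⊔ Ideal.span {X i + g} := sup_le_sup_right hle _
  obtain ⟨s, hsE, hsn, hsX⟩ := exists_socle (E := colonE (J ⊔ Ideal.span {X i + g}) (X i))
    (hnil.mono hle') (fun h => hpn (h hp))
  obtain ⟨κ, hκ, hκn, hκX⟩ := exists_socle hnil hne
  set t := (inVar i s).eval (-g) with ht
  have heval : ∀ q ∈ J', (inVar i q).eval (-g) ∈ J' := fun q hq => eval_mem_of_coeff_mem _ (h2 q hq)
  have hℓ : ∀ r, (inVar i ((X i + g) * r)).eval (-g) = 0 := by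
    intro r
    rw [map_mul, map_add, inVar_X_self, hg, Polynomial.eval_mul, Polynomial.eval_add,
      Polynomial.eval_X, Polynomial.eval_C, neg_add_cancel, zero_mul]
  have heval' : ∀ q ∈ J' ⊔ Ideal.span {X i + g}, (inVar i q).eval (-g) ∈ J' := by
    intro q hq
    obtain ⟨r, hr⟩ := mem_sup_span_singleton'.1 hq
    have := heval _ hr
    rwa [map_sub, Polynomial.eval_sub, hℓ, sub_zero] at this
  obtain ⟨a, ha⟩ : X i + g ∣ s - t := by
    have := Polynomial.sub_dvd_eval_sub (X i) (-g) (inVar i s)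
    rwa [eval_inVar, sub_neg_eq_add] at this
  have htn : t ∉ J' ⊔ Ideal.span {X i + g} := by
    intro h
    apply hsn
    have : s = t + (X i + g) * a := by rw [← ha]; ring
    rw [this]
    exact Ideal.add_mem _ h (Ideal.mem_sup_right
      (Ideal.mul_mem_right _ _ (Ideal.mem_span_singleton_self _)))
  have htX : ∀ j ≠ i, X j * t ∈ J' := by
    intro j hj
    have := heval' _ (hsX j)
    rwa [map_mul, inVar_X_ne hj, Polynomial.eval_mul, Polynomial.eval_C] at this
  have htg : g * t ∈ J' := by
    have := heval' _ (hsX i)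
    rw [map_mul, inVar_X_self, Polynomial.eval_mul, Polynomial.eval_X, neg_mul] at this
    simpa using J'.neg_mem this
  obtain ⟨m, hm⟩ : ∃ m, X i * t - (X i + g) * m ∈ J := by
    obtain ⟨r, hr⟩ := mem_sup_span_singleton'.1 (show X i * s ∈ J ⊔ Ideal.span {X i + g} from hsE)
    refine ⟨r - X i * a, ?_⟩
    have : X i * t - (X i + g) * (r - X i * a) = X i * s - (X i + g) * r := by
      have : s = t + (X i + g) * a := by rw [← ha]; ring
      rw [this]; ring
    rwa [this]
  have hδ := h1 _ hm
  rw [map_sub, map_mul, map_mul, map_add, inVar_X_self, hg, inVar_eval hg] at hδ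
  set P := inVar i m with hP
  rw [add_mul, mem_coeffIdeal] at hδ
  have h0 : g * P.coeff 0 ∈ J := by
    have := hδ.1
    simp only [Polynomial.coeff_sub, Polynomial.coeff_add, Polynomial.mul_coeff_zero,
      Polynomial.coeff_X_zero, zero_mul, zero_add, zero_sub, Polynomial.coeff_C_zero] at this
    simpa using J.neg_mem this
  have hsucc : ∀ j, P.coeff (j + 1) ∈ J' := by
    refine coeff_mem_of_recurrence (g := g) fun j => ?_
    have := hδ.2 (j + 2)
    rw [Polynomial.coeff_sub, Polynomial.coeff_add, Polynomial.coeff_X_mul,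
      Polynomial.coeff_X_mul, Polynomial.coeff_C_succ, Polynomial.coeff_C_mul, zero_sub] at this
    simpa using J'.neg_mem this
  have hm0 : t - P.coeff 0 ∈ J' := by
    have := hδ.2 (0 + 1)
    rw [Polynomial.coeff_sub, Polynomial.coeff_add, Polynomial.coeff_X_mul,
      Polynomial.coeff_X_mul, Polynomial.coeff_C_zero, Polynomial.coeff_C_mul] at this
    have h3 := J'.add_mem this (J'.mul_mem_left g (hsucc 0))
    have e : t - (P.coeff 0 + g * P.coeff (0 + 1)) + g * P.coeff (0 + 1) = t - P.coeff 0 := by ring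
    rwa [e] at h3
  have hsoc : ∀ j, X j * P.coeff 0 ∈ J ⊔ Ideal.span {X i + g} := by
    intro j
    by_cases hj : j = i
    · subst hj
      refine mem_sup_span_singleton'.2 ⟨P.coeff 0, ?_⟩
      have e : X j * P.coeff 0 - (X j + g) * P.coeff 0 = - (g * P.coeff 0) := by ring
      rw [e]; exact J.neg_mem h0
    · refine Ideal.mem_sup_left (hreg _ ?_)
      have h3 : X j * P.coeff 0 ∈ J' := by
        have := J'.sub_mem (htX j hj) (J'.mul_mem_left (X j) hm0)
        have e : X j * t - X j * (t - P.coeff 0) = X j * P.coeff 0 := by ring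
        rwa [e] at this
      have e : (X i + g) * (X j * P.coeff 0) = X i * (X j * P.coeff 0) + X j * (g * P.coeff 0) := by
        ring
      rw [e]
      exact J.add_mem (hX _ h3) (J.mul_mem_left _ h0)
  obtain ⟨b, hb⟩ := hgor κ (P.coeff 0) hκX hsoc hκn
  apply htn
  have e : t = (t - P.coeff 0) + (P.coeff 0 - C b * κ) + C b * κ := by ring
  rw [e]
  exact Ideal.add_mem _ (Ideal.add_mem _ (Ideal.mem_sup_left hm0) (hle' hb))
    (Ideal.mem_sup_left (J'.mul_mem_left _ hκ))

/-- The forms `U` are regular modulo `I_D` with Artinian Gorenstein quotient. -/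
structure Good (D : SC n) (U : Submodule k (Fin n → k)) : Prop where
  regV : RegV (srIdeal k D) U
  gor : Gor1 (srIdeal k D ⊔ LI U)
  nil : NilX (srIdeal k D ⊔ LI U)

/-- `D` is not a cone with apex `i`. -/
def NonCone (i : Fin n) (D : SC n) : Prop := ∃ τ ∈ D.faces, insert i τ ∉ D.faces

lemma sum_mul_single (u : Fin n → k) (i : Fin n) :
    ∑ j, u j * (Pi.single i (1 : k) : Fin n → k) j = u i := by
  rw [Finset.sum_eq_single i]
  · simp
  · intro b _ hb; simp [hb]
  · simp

lemma linForm_single (i : Fin n) : linForm k (Pi.single i (1 : k) : Fin n → k) = X i := by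
  rw [linForm, Finset.sum_eq_single i]
  · simp
  · intro b _ hb; simp [hb]
  · simp

lemma Good.exists_form {D : SC n} {U : Submodule k (Fin n → k)} (h : Good D U) {i : Fin n}
    (hi : {i} ∈ D.faces) : ∃ u ∈ U, u i = 1 := by
  by_contra hc
  push Not at hc
  have h0 : ∀ u ∈ U, u i = 0 := by
    intro u hu
    by_contra hui
    exact hc _ (U.smul_mem (u i)⁻¹ hu) (by simp [hui])
  have := point_eq_zero h.nil hi (p := Pi.single i 1)
    (fun j hj => by simpa [Pi.single_apply] using hj)
    (fun u hu => by rw [sum_mul_single, h0 u hu])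
  have := congrFun this i
  simp at this

lemma Good.colon {D : SC n} {U : Submodule k (Fin n → k)} (h : Good D U) {i : Fin n}
    (hcone : NonCone i D) {b : MvPolynomial (Fin n) k}
    (hb : X i * b ∈ srIdeal k D ⊔ LI U) : b ∈ srIdeal k (star {i} D) ⊔ LI U := by
  by_cases hi : {i} ∈ D.faces
  swap
  · refine Ideal.mem_sup_left ?_
    rw [← X_mul_mem_srIdeal]
    refine Ideal.mul_mem_right _ _ ?_
    simpa using xFace_mem_srIdeal (k := k) hi
  obtain ⟨u, hu, hui⟩ := h.exists_form hi
  set U0 : Submodule k (Fin n → k) := U ⊓ LinearMap.ker (LinearMap.proj i) with hU0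
  have hU0i : ∀ w ∈ U0, w i = 0 := fun w hw => by simpa using hw.2
  have hsup : U0 ⊔ k ∙ u = U := by
    apply le_antisymm
    · exact sup_le inf_le_left ((Submodule.span_singleton_le_iff_mem _ _).2 hu)
    · intro w hw
      refine mem_sup_span_vec.2 ⟨w - w i • u, ⟨U.sub_mem hw (U.smul_mem _ hu), ?_⟩, w i, by simp⟩
      simp [hui]
  have hu0 : u ∉ U0 := fun hc => by simpa [hui] using hU0i u hc
  have hU0U : U0 ≤ U := inf_le_left
  set g := linForm k (u - Pi.single i 1) with hg
  have hℓ : linForm k u = X i + g := by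
    rw [hg, ← linForm_single i, ← linForm_add, add_sub_cancel]
  have hstar : star {i} (star {i} D) = star {i} D := by rw [star_star, Finset.union_self]
  have eU : ∀ E : SC n, srIdeal k E ⊔ LI U = srIdeal k E ⊔ LI U0 ⊔ Ideal.span {X i + g} := by
    intro E
    rw [← hℓ, ← sup_LI_span, hsup]
  have hreg : Reg (srIdeal k D ⊔ LI U0) (X i + g) := by
    rw [← hℓ]; exact h.regV U0 hU0U u hu hu0
  have hX : ∀ p ∈ srIdeal k (star {i} D) ⊔ LI U0, X i * p ∈ srIdeal k D ⊔ LI U0 :=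
    fun p hp => X_mul_mem hp
  have hXconv : ∀ p, X i * p ∈ srIdeal k D ⊔ LI U0 → p ∈ srIdeal k (star {i} D) ⊔ LI U0 := by
    intro p hp
    have := (inVar_mem hU0i hp).2
    rw [← eval_inVar i p]
    refine eval_mem_of_coeff_mem _ fun j => ?_
    have := this (j + 1)
    rwa [map_mul, inVar_X_self, Polynomial.coeff_X_mul] at this
  have hle : srIdeal k D ⊔ LI U0 ≤ srIdeal k (star {i} D) ⊔ LI U0 :=
    sup_le_sup_right (srIdeal_le_star D _) _
  have hI0 : IsHom (srIdeal k D ⊔ LI U0) := (srIdeal_isHom D).sup (LI_isHom U0)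
  rw [eU] at hb ⊢
  refine colon_of_reduction hle hX ?_ (fun p hp => inVar_mem hU0i hp) ?_ hreg ?_ ?_ ?_ hb
  · exact inVar_linForm (by simp [hui])
  · intro p hp
    have := (inVar_mem hU0i hp).2
    rwa [hstar] at this
  · rw [← eU]; exact h.gor
  · rw [← eU]; exact h.nil
  · intro hc
    have hJJ : srIdeal k (star {i} D) ⊔ LI U0 ≤ srIdeal k D ⊔ LI U0 := by
      refine graded_nakayama (z := X i + g) ((srIdeal_isHom _).sup (LI_isHom U0)) hI0
        (by rw [← hℓ]; exact linForm_isHomogeneous u) fun p hp => ?_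
      obtain ⟨r, hr⟩ := mem_sup_span_singleton'.1 (hc hp)
      refine ⟨r, hXconv r (hreg _ ?_), hr⟩
      have e : (X i + g) * (X i * r) = X i * p - X i * (p - (X i + g) * r) := by ring
      rw [e]
      exact Ideal.sub_mem _ (hX p hp) (Ideal.mul_mem_left _ _ hr)
    have hXreg : Reg (srIdeal k D ⊔ LI U0) (X i) := fun p hp => hJJ (hXconv p hp)
    have hdesc : ∀ W ≤ U0, Reg (srIdeal k D ⊔ LI W) (X i) := by
      refine subspace_descending hXreg fun W hW w hw hwW hQ => ?_
      rw [sup_LI_span] at hQ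
      exact Reg.of_quotient ((srIdeal_isHom D).sup (LI_isHom W)) (linForm_isHomogeneous w)
        (isHomogeneous_X k i) (h.regV W (hW.trans hU0U) w (hU0U hw) hwW) hQ
    have h0 := hdesc ⊥ bot_le
    rw [LI_bot, sup_bot_eq] at h0
    obtain ⟨τ, hτ, hiτ⟩ := hcone
    refine xFace_notMem_srIdeal (k := k) hτ (h0 _ ?_)
    rw [X_mul_mem_srIdeal]
    refine xFace_mem_srIdeal ?_
    rwa [mem_star, ← Finset.insert_eq]

lemma Good.star_vertex {D : SC n} {U : Submodule k (Fin n → k)} (h : Good D U) {i : Fin n}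
    (hcone : NonCone i D) : Good (star {i} D) U := by
  have key : ∀ W ≤ U, ∀ p, X i * p ∈ srIdeal k D ⊔ LI W → p ∈ srIdeal k (star {i} D) ⊔ LI W := by
    refine subspace_descending (fun p hp => h.colon hcone hp) fun W hW w hw hwW hQ => ?_
    refine graded_nakayama (S := colonE (srIdeal k D ⊔ LI W) (X i)) (z := linForm k w)
      (((srIdeal_isHom D).sup (LI_isHom W)).colonE (isHomogeneous_X k i))
      ((srIdeal_isHom _).sup (LI_isHom W)) (linForm_isHomogeneous w) fun p hp => ?_
    have hp' : X i * p ∈ srIdeal k D ⊔ LI W := hp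
    have h1 := hQ p (by rw [sup_LI_span]; exact Ideal.mem_sup_left hp')
    rw [sup_LI_span] at h1
    obtain ⟨r, hr⟩ := mem_sup_span_singleton'.1 h1
    refine ⟨r, h.regV W hW w hw hwW _ ?_, hr⟩
    have e : linForm k w * (LinearMap.mulLeft (MvPolynomial (Fin n) k) (X i)) r =
        X i * p - X i * (p - linForm k w * r) := by
      rw [LinearMap.mulLeft_apply]; ring
    rw [e]
    exact Ideal.sub_mem _ hp' (X_mul_mem hr)
  refine ⟨fun W hW w hw hwW p hp => key W hW p (h.regV W hW w hw hwW _ ?_), ?_,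
    h.nil.mono (sup_le_sup_right (srIdeal_le_star D _) _)⟩
  · have := X_mul_mem hp
    rwa [mul_left_comm] at this
  · intro u v hu hv hun
    obtain ⟨a, ha⟩ := h.gor (X i * u) (X i * v)
      (fun j => by rw [mul_left_comm]; exact X_mul_mem (hu j))
      (fun j => by rw [mul_left_comm]; exact X_mul_mem (hv j))
      (fun hc => hun (h.colon hcone hc))
    refine ⟨a, h.colon hcone ?_⟩
    rwa [mul_sub, mul_left_comm]

lemma LI_hc_one {U : Submodule k (ι → k)} {b : MvPolynomial ι k} (hb : b ∈ LI U) :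
    ∃ h ∈ U, homogeneousComponent 1 b = linForm k h := by
  rw [LI] at hb
  induction hb using Submodule.closure_induction with
  | zero => exact ⟨0, U.zero_mem, by simp [linForm]⟩
  | add x y _ _ hx hy =>
    obtain ⟨h1, h1U, e1⟩ := hx
    obtain ⟨h2, h2U, e2⟩ := hy
    exact ⟨h1 + h2, U.add_mem h1U h2U, by rw [map_add, e1, e2, linForm_add]⟩
  | smul_mem r x hx =>
    obtain ⟨u, hu, rfl⟩ := hx
    refine ⟨coeff 0 r • u, U.smul_mem _ hu, ?_⟩
    rw [smul_eq_mul, mul_comm]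
    have := hc_mul (linForm_isHomogeneous u) r 0
    rw [add_zero] at this
    rw [this, homogeneousComponent_zero, linForm_smul, mul_comm]

lemma Good.isHom (D : SC n) (U : Submodule k (Fin n → k)) : IsHom (srIdeal k D ⊔ LI U) :=
  (srIdeal_isHom D).sup (LI_isHom U)

lemma Good.exists_PD {D : SC n} {U : Submodule k (Fin n → k)} (h : Good D U) (hD : ∅ ∈ D.faces) :
    ∃ e, PD (srIdeal k D ⊔ LI U) e :=
  SRWLP.exists_PD (Good.isHom D U) h.nil h.gor fun hc => one_notMem U hD (hc ▸ Submodule.mem_top)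

lemma nonCone_ne {i v : Fin n} (D : SC n) (hi : {i} ∈ D.faces) (hvi : v ≠ i) (l : k) :
    (X i - C l * X v : MvPolynomial (Fin n) k) ∉ srIdeal k D := by
  intro h
  have h1 := mem_srIdeal.1 h (Finsupp.single i 1) ?_
  · exact h1 (by rwa [Finsupp.support_single i one_ne_zero])
  · have hne : (Finsupp.single v 1 : Fin n →₀ ℕ) ≠ Finsupp.single i 1 := fun hc =>
      hvi (Finsupp.single_left_injective one_ne_zero hc)
    rw [mem_support_iff, coeff_sub, coeff_C_mul, coeff_X, coeff_X, if_pos rfl, if_neg hne]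
    simp

lemma Good.nonCone_star {D : SC n} {U : Submodule k (Fin n → k)} (h : Good D U) {i v : Fin n}
    (hi : {i} ∈ D.faces) (hci : NonCone i D) (hcv : NonCone v D) (hvi : v ≠ i) :
    NonCone v (star {i} D) := by
  by_contra hc
  have hE : ∅ ∈ D.faces := D.down_closed _ hi _ (Finset.empty_subset _)
  have hXi : X i ∉ srIdeal k D ⊔ LI U := by
    intro hx
    rw [← mul_one (X i)] at hx
    refine one_notMem U ?_ (h.colon hci hx)
    rw [mem_star]; simpa using hi
  have hcone : ∀ τ ∈ (star {i} D).faces, insert v τ ∈ (star {i} D).faces := by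
    intro τ hτ
    by_contra hn
    exact hc ⟨τ, hτ, hn⟩
  have hstar : star {v} (star {i} D) = star {i} D := by
    refine SC.ext' fun τ => ?_
    rw [mem_star]
    refine ⟨fun hm => (star {i} D).down_closed _ hm _ Finset.subset_union_right, fun hm => ?_⟩
    rw [← Finset.insert_eq]
    exact hcone τ hm
  have hgv := h.star_vertex hcv
  by_cases hiv : NonCone i (star {v} D)
  · have hstar' : star {i} (star {v} D) = star {i} D := by
      rw [star_star, Finset.union_comm, ← star_star, hstar]
    obtain ⟨N, hN⟩ := h.nil v
    have key : ∀ N, X v ^ N * X i ∈ srIdeal k D ⊔ LI U → X i ∈ srIdeal k D ⊔ LI U := by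
      intro N
      induction N with
      | zero => intro hm; simpa using hm
      | succ N ih =>
        intro hm
        apply ih
        rw [mul_comm]
        apply X_mul_mem
        rw [← hstar']
        apply hgv.colon hiv
        apply h.colon hcv
        convert hm using 1
        ring
    exact hXi (key N (Ideal.mul_mem_right _ _ hN))
  · have hcone' : ∀ τ ∈ (star {v} D).faces, insert i τ ∈ (star {v} D).faces := by
      intro τ hτ
      by_contra hn
      exact hiv ⟨τ, hτ, hn⟩
    have hvS : star {v} D = star {i} D := by
      rw [← hstar, star_star, Finset.union_comm, ← star_star]
      refine SC.ext' fun τ => ?_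
      rw [mem_star (σ := {i})]
      refine ⟨fun hm => ?_, fun hm => (star {v} D).down_closed _ hm _ Finset.subset_union_right⟩
      rw [← Finset.insert_eq]
      exact hcone' τ hm
    have hvcolon : ∀ {b}, X v * b ∈ srIdeal k D ⊔ LI U → b ∈ srIdeal k (star {i} D) ⊔ LI U := by
      intro b hb
      rw [← hvS]
      exact h.colon hcv hb
    have hvmul : ∀ {b}, b ∈ srIdeal k (star {i} D) ⊔ LI U → X v * b ∈ srIdeal k D ⊔ LI U := by
      intro b hb
      apply X_mul_mem
      rwa [hvS]
    obtain ⟨e, hPD⟩ := h.exists_PD hE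
    obtain ⟨t, w, hte, hw, hwX⟩ := hPD.1 1 (X i) (isHomogeneous_X k i) hXi
    have hwv : w * X v ∉ srIdeal k D ⊔ LI U := by
      intro hm
      rw [mul_comm] at hm hwX
      exact hwX (X_mul_mem (hvcolon hm))
    obtain ⟨l, hl⟩ := hPD.2 (w * X v) (w * X i)
      (by rw [← hte, add_comm]; exact hw.mul (isHomogeneous_X k v))
      (by rw [← hte, add_comm]; exact hw.mul (isHomogeneous_X k i)) hwv
    have hyhom : (X i - C l * X v : MvPolynomial (Fin n) k).IsHomogeneous 1 := by
      refine (isHomogeneous_X k i).sub ?_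
      have := (isHomogeneous_C (Fin n) l).mul (isHomogeneous_X k v)
      rwa [zero_add] at this
    have hyw : w * (X i - C l * X v) ∈ srIdeal k D ⊔ LI U := by
      convert hl using 1
      ring
    have hy : X i - C l * X v ∈ srIdeal k D ⊔ LI U := by
      by_contra hy
      obtain ⟨t', a, hte', ha, hay⟩ := hPD.1 1 _ hyhom hy
      obtain ⟨μ, hμ⟩ := hPD.2 (w * X i) (a * X i)
        (by rw [← hte, add_comm]; exact hw.mul (isHomogeneous_X k i))
        (by rw [← hte', add_comm]; exact ha.mul (isHomogeneous_X k i)) hwX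
      have h1 : a - C μ * w ∈ srIdeal k (star {i} D) ⊔ LI U := by
        apply h.colon hci
        convert hμ using 1
        ring
      apply hay
      have e : a * (X i - C l * X v) = X i * (a - C μ * w) - C l * (X v * (a - C μ * w)) +
          C μ * (w * (X i - C l * X v)) := by ring
      rw [e]
      exact Ideal.add_mem _ (Ideal.sub_mem _ (X_mul_mem h1) (Ideal.mul_mem_left _ _ (hvmul h1)))
        (Ideal.mul_mem_left _ _ hyw)
    obtain ⟨a, ha, b, hb, hab⟩ := Submodule.mem_sup.1 hy
    obtain ⟨f, hf, hbf⟩ := LI_hc_one hb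
    have hyf : X i - C l * X v - linForm k f ∈ srIdeal k D := by
      have h1 := srIdeal_isHom D a ha 1
      have h2 : homogeneousComponent 1 (a + b) = X i - C l * X v := by
        rw [hab, hc_of_mem hyhom]
      rw [map_add, hbf] at h2
      rw [← h2, add_sub_cancel_right]
      exact h1
    obtain ⟨τ, hτ, hτv⟩ := hcv
    have hxv : X v * xFace k τ ∈ srIdeal k D := by
      rw [X_mul_mem_srIdeal]
      refine xFace_mem_srIdeal ?_
      rwa [mem_star, ← Finset.insert_eq]
    have hxi : X i * xFace k τ ∈ srIdeal k D := by
      rw [X_mul_mem_srIdeal, ← hvS, ← X_mul_mem_srIdeal]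
      exact hxv
    have hfτ : linForm k f * xFace k τ ∈ srIdeal k D := by
      have e : linForm k f * xFace k τ = X i * xFace k τ - C l * (X v * xFace k τ) -
          (X i - C l * X v - linForm k f) * xFace k τ := by ring
      rw [e]
      exact Ideal.sub_mem _ (Ideal.sub_mem _ hxi (Ideal.mul_mem_left _ _ hxv))
        (Ideal.mul_mem_right _ _ hyf)
    by_cases hf0 : f = 0
    · subst hf0
      have : linForm k (0 : Fin n → k) = 0 := by simp [linForm]
      rw [this, sub_zero] at hyf
      exact nonCone_ne D hi hvi l hyf
    · have h1 := h.regV ⊥ bot_le f hf (by simpa using hf0)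
      rw [LI_bot, sup_bot_eq] at h1
      exact xFace_notMem_srIdeal hτ (h1 _ hfτ)

lemma Good.star_face {D : SC n} {U : Submodule k (Fin n → k)} (h : Good D U)
    (hD : ∀ v, NonCone v D) {σ : Finset (Fin n)} (hσ : σ ∈ D.faces) :
    Good (star σ D) U ∧
      (∀ b, xFace k σ * b ∈ srIdeal k D ⊔ LI U → b ∈ srIdeal k (star σ D) ⊔ LI U) ∧
      ∀ v ∉ σ, NonCone v (star σ D) := by
  induction σ using Finset.induction with
  | empty =>
    have : star ∅ D = D := by
      refine SC.ext' fun τ => ?_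
      rw [mem_star, Finset.empty_union]
    rw [this]
    exact ⟨h, fun b hb => by simpa [xFace] using hb, fun v _ => hD v⟩
  | insert i σ hiσ ih =>
    obtain ⟨h1, h2, h3⟩ := ih (D.down_closed _ hσ _ (Finset.subset_insert i σ))
    have e : star (insert i σ) D = star {i} (star σ D) := by
      rw [star_star, Finset.insert_eq, Finset.union_comm]
    rw [e]
    refine ⟨h1.star_vertex (h3 i hiσ), fun b hb => ?_, fun v hv => ?_⟩
    · refine h1.colon (h3 i hiσ) (h2 _ ?_)
      rw [xFace, Finset.prod_insert hiσ] at hb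
      convert hb using 1
      rw [xFace]; ring
    · rw [Finset.mem_insert, not_or] at hv
      refine h1.nonCone_star ?_ (h3 i hiσ) (h3 v hv.2) hv.1
      rw [mem_star, Finset.union_comm, ← Finset.insert_eq]
      exact hσ

lemma mem_of_X_mem {J : Ideal (MvPolynomial ι k)} (hX : ∀ j, X j ∈ J) {t : ℕ} (ht : t ≠ 0)
    {r : MvPolynomial ι k} (hr : r.IsHomogeneous t) : r ∈ J := by
  have hle : Ideal.span (Set.range (X : ι → MvPolynomial ι k)) ≤ J := by
    rw [Ideal.span_le]
    rintro _ ⟨j, rfl⟩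
    exact hX j
  apply hle
  rw [← Set.image_univ, mem_ideal_span_X_image]
  intro m hm
  by_contra hc
  push Not at hc
  have hm0 : m = 0 := by
    ext j
    exact hc j (Set.mem_univ j)
  have := hr (mem_support_iff.1 hm)
  rw [hm0, map_zero] at this
  omega

lemma PD.degree_add {D : SC n} {U : Submodule k (Fin n → k)} {F : Finset (Fin n)}
    (hF : F ∈ D.faces)
    (hcol : ∀ b, xFace k F * b ∈ srIdeal k D ⊔ LI U → b ∈ srIdeal k (star F D) ⊔ LI U)
    {d' e' : ℕ} (hA : PD (srIdeal k D ⊔ LI U) d') (hB : PD (srIdeal k (star F D) ⊔ LI U) e') :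
    e' + F.card = d' := by
  have hE : ∅ ∈ (star F D).faces := by rw [mem_star]; simpa using hF
  have hmul : ∀ b ∈ srIdeal k (star F D) ⊔ LI U, xFace k F * b ∈ srIdeal k D ⊔ LI U := by
    intro b hb
    obtain ⟨a, ha, c, hc, rfl⟩ := Submodule.mem_sup.1 hb
    rw [mul_add]
    exact Submodule.add_mem_sup (xFace_mul_mem_srIdeal.2 ha) (Ideal.mul_mem_left _ _ hc)
  obtain ⟨t, r, ht, hr, hrn⟩ := hB.1 0 1 (isHomogeneous_one _ _) (one_notMem U hE)
  rw [mul_one] at hrn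
  have hxhom : (xFace k F).IsHomogeneous F.card := by
    have := IsHomogeneous.prod F (fun i => (X i : MvPolynomial (Fin n) k)) (fun _ => 1)
      fun i _ => isHomogeneous_X k i
    simpa [xFace] using this
  obtain ⟨t', r', ht', hr', hrn'⟩ := hA.1 _ _ (hxhom.mul hr) (fun hm => hrn (hcol _ hm))
  rcases Nat.eq_zero_or_pos t' with h0 | h0
  · omega
  · exfalso
    apply hrn'
    rw [mul_left_comm]
    exact hmul _ (hB.mem_of_gt (m := t' + t) (by omega) (hr'.mul hr))

lemma PD.dimP_eq {D : SC n} {U : Submodule k (Fin n → k)} (h : Good D U)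
    (hD : ∀ v, NonCone v D) (hE : ∅ ∈ D.faces) {d' : ℕ} (hA : PD (srIdeal k D ⊔ LI U) d') :
    d' = dimP D := by
  obtain ⟨F, hF, hFd⟩ := Finset.exists_mem_eq_sup D.faces ⟨_, hE⟩ Finset.card
  obtain ⟨h1, h2, -⟩ := h.star_face hD hF
  have hE' : ∅ ∈ (star F D).faces := by rw [mem_star]; simpa using hF
  obtain ⟨e', hB⟩ := h1.exists_PD hE'
  have hdeg := PD.degree_add hF h2 hA hB
  rw [dimP, hFd, ← hdeg]
  suffices e' = 0 by omega
  have hX : ∀ j, X j ∈ srIdeal k (star F D) ⊔ LI U := by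
    have hXn : ∀ j ∉ F, X j ∈ srIdeal k (star F D) := by
      intro j hj
      have : ({j} : Finset (Fin n)) ∉ (star F D).faces := by
        intro hm
        rw [mem_star, Finset.union_comm, ← Finset.insert_eq] at hm
        have := Finset.le_sup (f := Finset.card) hm
        rw [hFd, Finset.card_insert_of_notMem hj] at this
        omega
      simpa using xFace_mem_srIdeal (k := k) this
    set V : Submodule k (Fin n → k) :=
      U ⊔ Submodule.span k {x | ∃ j ∉ F, x = Pi.single j 1} with hV
    have hVle : LI V ≤ srIdeal k (star F D) ⊔ LI U := by
      rw [hV, LI_sup]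
      refine sup_le le_sup_right (le_trans ?_ le_sup_left)
      rw [LI_span, Ideal.span_le]
      rintro _ ⟨_, ⟨j, hj, rfl⟩, rfl⟩
      rw [linForm_single]
      exact hXn j hj
    have hVtop : V = ⊤ := by
      by_contra hne
      obtain ⟨f, hf0, hf⟩ := Submodule.exists_le_ker_of_lt_top V (lt_top_iff_ne_top.2 hne)
      apply hf0
      have hfe : ∀ u : Fin n → k, f u = ∑ i, u i * f (Pi.single i 1) := by
        intro u
        conv_lhs => rw [pi_eq_sum_univ' u, map_sum]
        refine Finset.sum_congr rfl fun j _ => ?_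
        rw [map_smul, smul_eq_mul]
      have hp := point_eq_zero h.nil hF (p := fun i => f (Pi.single i 1))
        (fun i hi => hf (Submodule.mem_sup_right (Submodule.subset_span ⟨i, hi, rfl⟩)))
        (fun u hu => by rw [← hfe]; exact hf (Submodule.mem_sup_left hu))
      ext i
      simpa using congrFun hp i
    intro j
    have := linForm_mem_LI (k := k) (U := V) (h := Pi.single j 1) (by rw [hVtop]; trivial)
    rw [linForm_single] at this
    exact hVle this
  obtain ⟨t, r, ht, hr, hrn⟩ := hB.1 0 1 (isHomogeneous_one _ _) (one_notMem U hE')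
  rw [mul_one] at hrn
  by_contra he
  apply hrn
  exact mem_of_X_mem hX he (by simpa [← ht] using hr)

lemma finite_homogeneousSubmodule (m : ℕ) : Module.Finite k (homogeneousSubmodule ι k m) :=
  Module.Finite.iff_fg.2 (homogeneousSubmodule_fg _ _ m)

/-- Multiplication by `θ` modulo `J` is injective in degree `m`. -/
def Inj (J : Ideal (MvPolynomial ι k)) (θ : MvPolynomial ι k) (m : ℕ) : Prop :=
  ∀ p : MvPolynomial ι k, p.IsHomogeneous m → θ * p ∈ J → p ∈ J

/-- Every form of degree `m` is a multiple of `θ` modulo `J`. -/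
def Sur (J : Ideal (MvPolynomial ι k)) (θ : MvPolynomial ι k) (m : ℕ) : Prop :=
  ∀ y : MvPolynomial ι k, y.IsHomogeneous m → y ∈ J ⊔ Ideal.span {θ}

lemma IsHom.exists_homogeneous_factor {J : Ideal (MvPolynomial ι k)} (hJ : IsHom J)
    {θ : MvPolynomial ι k} {t m : ℕ} (hθ : θ.IsHomogeneous t) {y : MvPolynomial ι k}
    (hy : y.IsHomogeneous (t + m)) (h : y ∈ J ⊔ Ideal.span {θ}) :
    ∃ r : MvPolynomial ι k, r.IsHomogeneous m ∧ y - θ * r ∈ J := by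
  obtain ⟨r, hr⟩ := mem_sup_span_singleton'.1 h
  refine ⟨homogeneousComponent m r, homogeneousComponent_isHomogeneous _ _, ?_⟩
  have := hJ _ hr (t + m)
  rwa [map_sub, hc_of_mem hy, hc_mul hθ] at this

lemma mem_qComp {J : Ideal (MvPolynomial ι k)} {m : ℕ} {x : MvPolynomial ι k ⧸ J} :
    x ∈ qComp k J m ↔ ∃ p : MvPolynomial ι k, p.IsHomogeneous m ∧ Ideal.Quotient.mk J p = x := by
  rw [qComp, Submodule.mem_map]
  rfl

lemma inj_iff {J : Ideal (MvPolynomial ι k)} {θ : MvPolynomial ι k} {m : ℕ} :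
    (∀ x ∈ qComp k J m, Ideal.Quotient.mk J θ * x = 0 → x = 0) ↔ Inj J θ m := by
  constructor
  · intro h p hp hθ
    rw [← Ideal.Quotient.eq_zero_iff_mem] at hθ ⊢
    exact h _ (mem_qComp.2 ⟨p, hp, rfl⟩) (by rw [← map_mul, hθ])
  · intro h x hx h0
    obtain ⟨p, hp, rfl⟩ := mem_qComp.1 hx
    rw [← map_mul, Ideal.Quotient.eq_zero_iff_mem] at h0
    exact Ideal.Quotient.eq_zero_iff_mem.2 (h p hp h0)

lemma mulMaxRank_iff {J : Ideal (MvPolynomial ι k)} (hJ : IsHom J) {θ : MvPolynomial ι k}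
    (hθ : θ.IsHomogeneous 1) {m : ℕ} :
    mulMaxRank k J (Ideal.Quotient.mk J θ) m ↔ Inj J θ m ∨ Sur J θ (m + 1) := by
  rw [mulMaxRank, inj_iff]
  refine or_congr Iff.rfl ⟨fun h y hy => ?_, fun h y hy => ?_⟩
  · obtain ⟨x, hx, hxy⟩ := h _ (mem_qComp.2 ⟨y, hy, rfl⟩)
    obtain ⟨p, hp, rfl⟩ := mem_qComp.1 hx
    refine mem_sup_span_singleton'.2 ⟨p, ?_⟩
    rw [← Ideal.Quotient.eq_zero_iff_mem, map_sub, map_mul, hxy, sub_self]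
  · obtain ⟨z, hz, rfl⟩ := mem_qComp.1 hy
    obtain ⟨r, hr, hr'⟩ := hJ.exists_homogeneous_factor hθ (by rwa [add_comm]) (h z hz)
    refine ⟨_, mem_qComp.2 ⟨r, hr, rfl⟩, ?_⟩
    rw [← map_mul]
    rw [← Ideal.Quotient.eq_zero_iff_mem, map_sub, sub_eq_zero] at hr'
    exact hr'.symm

lemma propM_iff {J : Ideal (MvPolynomial (Fin n) k)} {θ : MvPolynomial (Fin n) k} {q p₁ : ℕ} :
    (∀ x ∈ qCompZ k J ((p₁ : ℤ) - (q : ℤ)), Ideal.Quotient.mk J θ ^ q * x = 0 → x = 0) ↔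
      ∀ j, j + q = p₁ → Inj J (θ ^ q) j := by
  rw [← map_pow]
  by_cases hq : q ≤ p₁
  · have e : qCompZ k J ((p₁ : ℤ) - (q : ℤ)) = qComp k J (p₁ - q) := by
      rw [qCompZ, if_pos (by omega)]
      congr 1
      omega
    rw [e, inj_iff]
    constructor
    · intro h j hj
      have : j = p₁ - q := by omega
      rwa [this]
    · intro h
      exact h _ (by omega)
  · have e : qCompZ k J ((p₁ : ℤ) - (q : ℤ)) = ⊥ := by
      rw [qCompZ, if_neg (by omega)]
    rw [e]
    refine ⟨fun _ j hj => by omega, fun _ x hx _ => by simpa using hx⟩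

lemma PD.exists_functional {J : Ideal (MvPolynomial ι k)} {e : ℕ} (h : PD J e) :
    ∃ φ : MvPolynomial ι k →ₗ[k] k, ∀ r : MvPolynomial ι k, r.IsHomogeneous e →
      (r ∈ J ↔ φ r = 0) := by
  by_cases hw : ∃ w : MvPolynomial ι k, w.IsHomogeneous e ∧ w ∉ J
  · obtain ⟨w, hwe, hw⟩ := hw
    obtain ⟨φ, hφw, hφ⟩ := Submodule.exists_le_ker_of_notMem (p := J.restrictScalars k) (v := w) hw
    refine ⟨φ, fun r hr => ⟨fun hrJ => hφ hrJ, fun hr0 => ?_⟩⟩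
    obtain ⟨a, ha⟩ := h.2 w r hwe hr hw
    have h1 : φ (r - C a * w) = 0 := hφ ha
    rw [map_sub, hr0, ← smul_eq_C_mul, map_smul, smul_eq_mul, zero_sub, neg_eq_zero,
      mul_eq_zero, or_iff_left hφw] at h1
    rwa [h1, map_zero, zero_mul, sub_zero] at ha
  · push Not at hw
    exact ⟨0, fun r hr => ⟨fun _ => rfl, fun _ => hw r hr⟩⟩

lemma PD.inj_of_sur {J : Ideal (MvPolynomial ι k)} {e : ℕ} (h : PD J e) {θ : MvPolynomial ι k}
    {j m : ℕ} (hjm : j + m = e) (hs : Sur J θ m) : Inj J θ j := by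
  intro p hp hθp
  by_contra hpJ
  obtain ⟨t, r, hte, hr, hrp⟩ := h.1 j p hp hpJ
  obtain rfl : t = m := by omega
  obtain ⟨s, hs⟩ := mem_sup_span_singleton'.1 (hs r hr)
  apply hrp
  have e : r * p = (r - θ * s) * p + s * (θ * p) := by ring
  rw [e]
  exact J.add_mem (J.mul_mem_right _ hs) (J.mul_mem_left _ hθp)

lemma range_eq_dualAnnihilator_ker_flip {V W : Type*} [AddCommGroup V] [Module k V] [AddCommGroup W] [Module k W]
    [Module.Finite k V] [Module.Finite k W] (b : V →ₗ[k] Module.Dual k W) :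
    LinearMap.range b = (LinearMap.ker (LinearMap.flip b)).dualAnnihilator := by
  rw [← LinearMap.dualCoannihilator_range_eq_ker_flip, Subspace.dualCoannihilator_dualAnnihilator_eq]

/-- The pairing `(p, y) ↦ φ (p * y)` between forms of degrees `j` and `m`. -/
def mulPairing (φ : MvPolynomial ι k →ₗ[k] k) (j m : ℕ) :
    homogeneousSubmodule ι k j →ₗ[k] Module.Dual k (homogeneousSubmodule ι k m) :=
  (((LinearMap.mul k (MvPolynomial ι k)).compr₂ φ).domRestrict₁₂
    (homogeneousSubmodule ι k j) (homogeneousSubmodule ι k m))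

lemma mulPairing_apply (φ : MvPolynomial ι k →ₗ[k] k) {j m : ℕ}
    (p : homogeneousSubmodule ι k j) (y : homogeneousSubmodule ι k m) :
    mulPairing φ j m p y = φ (p * y) := rfl

lemma PD.sur_of_inj {J : Ideal (MvPolynomial ι k)} {e : ℕ} (h : PD J e) {θ : MvPolynomial ι k}
    {t : ℕ} (hθ : θ.IsHomogeneous t) {j m : ℕ} (hjm : j + m = e) (hi : Inj J θ j) :
    Sur J θ m := by
  intro y hy
  by_contra hyE
  obtain ⟨φ, hφ⟩ := h.exists_functional
  have := finite_homogeneousSubmodule (k := k) (ι := ι) j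
  have := finite_homogeneousSubmodule (k := k) (ι := ι) m
  obtain ⟨g, hgy, hg⟩ := Submodule.exists_le_ker_of_notMem
    (p := ((J ⊔ Ideal.span {θ}).restrictScalars k)) (v := y) hyE
  have hgr : g ∘ₗ (homogeneousSubmodule ι k m).subtype ∈ LinearMap.range (mulPairing φ j m) := by
    rw [range_eq_dualAnnihilator_ker_flip, Submodule.mem_dualAnnihilator]
    rintro ⟨z, hz⟩ hz0
    refine hg (Ideal.mem_sup_left (?_ : z ∈ J))
    by_contra hzJ
    obtain ⟨j', r, hr, hrh, hrz⟩ := h.1 m z hz hzJ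
    obtain rfl : j' = j := by omega
    apply hrz
    rw [hφ _ (by rw [← hjm]; exact hrh.mul hz)]
    have := LinearMap.congr_fun hz0 ⟨r, hrh⟩
    rwa [LinearMap.flip_apply, mulPairing_apply] at this
  obtain ⟨⟨p, hp⟩, hpg⟩ := hgr
  have hval : ∀ z : MvPolynomial ι k, z.IsHomogeneous m → φ (p * z) = g z := fun z hz =>
    LinearMap.congr_fun hpg ⟨z, hz⟩
  have hpJ : p ∈ J := by
    apply hi p hp
    by_contra hpθ
    obtain ⟨u, s, hu, hs, hsp⟩ := h.1 _ _ (hθ.mul hp) hpθ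
    apply hsp
    have hsθ : (θ * s).IsHomogeneous m := by
      have : m = t + u := by omega
      rw [this]; exact hθ.mul hs
    have e1 : s * (θ * p) = p * (θ * s) := by ring
    rw [e1, hφ _ (by rw [← hjm]; exact IsHomogeneous.mul hp hsθ), hval _ hsθ]
    exact hg (Ideal.mem_sup_right (Ideal.mul_mem_right _ _ (Ideal.mem_span_singleton_self θ)))
  apply hgy
  rw [← hval y hy, ← hφ _ (by rw [← hjm]; exact IsHomogeneous.mul hp hy)]
  exact J.mul_mem_right _ hpJ

lemma PD.inj_down {J : Ideal (MvPolynomial ι k)} {e : ℕ} (h : PD J e) {θ : MvPolynomial ι k}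
    {j j' : ℕ} (hj : j ≤ j') (hj' : j' ≤ e) (hi : Inj J θ j') : Inj J θ j := by
  induction j', hj using Nat.le_induction with
  | base => exact hi
  | succ m hm ih =>
    refine ih (by omega) fun p hp hθp => ?_
    by_contra hpJ
    obtain ⟨t, r, ht, hr, hrp⟩ := h.1 m p hp hpJ
    apply hrp
    rw [mul_comm]
    have hX : ∀ i, X i ∈ colonE J p := by
      intro i
      rw [mem_colonE]
      refine hi _ (hp.mul (isHomogeneous_X k i)) ?_
      rw [← mul_assoc]
      exact J.mul_mem_right _ hθp
    exact mem_of_X_mem hX (by omega) hr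

lemma PD.sur_of_gt {J : Ideal (MvPolynomial ι k)} {e : ℕ} (h : PD J e) {θ : MvPolynomial ι k}
    {m : ℕ} (hm : e < m) : Sur J θ m := fun _ hy => Ideal.mem_sup_left (h.mem_of_gt hm hy)

/-- The quotient map on forms of degree `m`. -/
def mkHom (J : Ideal (MvPolynomial ι k)) (m : ℕ) :
    homogeneousSubmodule ι k m →ₗ[k] MvPolynomial ι k ⧸ J :=
  (Ideal.Quotient.mkₐ k J).toLinearMap.domRestrict (homogeneousSubmodule ι k m)

lemma range_mkHom (J : Ideal (MvPolynomial ι k)) (m : ℕ) :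
    LinearMap.range (mkHom J m) = qComp k J m := by
  rw [mkHom, LinearMap.range_domRestrict, qComp]

lemma mem_ker_mkHom {J : Ideal (MvPolynomial ι k)} {m : ℕ} {p : homogeneousSubmodule ι k m} :
    p ∈ LinearMap.ker (mkHom J m) ↔ (p : MvPolynomial ι k) ∈ J := by
  rw [LinearMap.mem_ker]
  exact Ideal.Quotient.eq_zero_iff_mem

lemma finrank_qComp_eq {J : Ideal (MvPolynomial ι k)} {j m : ℕ}
    (b : homogeneousSubmodule ι k j →ₗ[k] Module.Dual k (homogeneousSubmodule ι k m))
    (h1 : ∀ p, b p = 0 ↔ (p : MvPolynomial ι k) ∈ J)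
    (h2 : ∀ y, b.flip y = 0 ↔ (y : MvPolynomial ι k) ∈ J) :
    Module.finrank k (qComp k J j) = Module.finrank k (qComp k J m) := by
  have := finite_homogeneousSubmodule (k := k) (ι := ι) j
  have := finite_homogeneousSubmodule (k := k) (ι := ι) m
  have e1 : LinearMap.ker b = LinearMap.ker (mkHom J j) := by
    ext p; rw [mem_ker_mkHom, LinearMap.mem_ker, h1]
  have e2 : LinearMap.ker b.flip = LinearMap.ker (mkHom J m) := by
    ext p; rw [mem_ker_mkHom, LinearMap.mem_ker, h2]
  have r1 := LinearMap.finrank_range_add_finrank_ker b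
  have r2 := LinearMap.finrank_range_add_finrank_ker (mkHom J j)
  have r3 := LinearMap.finrank_range_add_finrank_ker (mkHom J m)
  have r4 := Subspace.finrank_add_finrank_dualAnnihilator_eq (LinearMap.ker b.flip)
  rw [← range_eq_dualAnnihilator_ker_flip, e2] at r4
  rw [range_mkHom] at r2 r3
  rw [e1] at r1
  omega

lemma sur_of_inj_of_finrank {J : Ideal (MvPolynomial ι k)} {θ : MvPolynomial ι k}
    {t j : ℕ} (hθ : θ.IsHomogeneous t) (hi : Inj J θ j)
    (hdim : Module.finrank k (qComp k J j) = Module.finrank k (qComp k J (t + j))) :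
    Sur J θ (t + j) := by
  have := finite_homogeneousSubmodule (k := k) (ι := ι) j
  have := finite_homogeneousSubmodule (k := k) (ι := ι) (t + j)
  have : Module.Finite k (qComp k J j) := by rw [← range_mkHom]; infer_instance
  have : Module.Finite k (qComp k J (t + j)) := by rw [← range_mkHom]; infer_instance
  have hmap : ∀ x ∈ qComp k J j,
      LinearMap.mulLeft k (Ideal.Quotient.mk J θ) x ∈ qComp k J (t + j) := by
    intro x hx
    obtain ⟨p, hp, rfl⟩ := mem_qComp.1 hx
    exact mem_qComp.2 ⟨θ * p, hθ.mul hp, by rw [map_mul]; rfl⟩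
  have hinj : Function.Injective (LinearMap.restrict _ hmap) := by
    rw [← LinearMap.ker_eq_bot, LinearMap.ker_eq_bot']
    rintro ⟨x, hx⟩ h0
    exact Subtype.ext (inj_iff.2 hi x hx (congrArg Subtype.val h0))
  intro y hy
  obtain ⟨⟨x, hx⟩, hxy⟩ := (LinearMap.injective_iff_surjective_of_finrank_eq_finrank hdim).1 hinj
    ⟨_, mem_qComp.2 ⟨y, hy, rfl⟩⟩
  obtain ⟨p, hp, rfl⟩ := mem_qComp.1 hx
  refine mem_sup_span_singleton'.2 ⟨p, ?_⟩
  have h1 : Ideal.Quotient.mk J θ * Ideal.Quotient.mk J p = Ideal.Quotient.mk J y :=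
    congrArg Subtype.val hxy
  rw [← Ideal.Quotient.eq_zero_iff_mem, map_sub, map_mul, h1, sub_self]

/-- `R[T]` as univariate polynomials over `R`. -/
def polyT (n : ℕ) :
    MvPolynomial (Fin (n + 1)) k ≃ₐ[k] Polynomial (MvPolynomial (Fin n) k) :=
  (renameEquiv k (finRotate (n + 1))).trans (finSuccEquiv k n)

lemma polyT_X_castSucc (i : Fin n) :
    polyT n (X i.castSucc : MvPolynomial (Fin (n + 1)) k) = Polynomial.C (X i) := by
  rw [polyT, AlgEquiv.trans_apply, renameEquiv_apply, rename_X]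
  have : finRotate (n + 1) i.castSucc = i.succ := by
    ext
    rw [coe_finRotate_of_ne_last (Fin.castSucc_ne_last i)]
    rfl
  rw [this, finSuccEquiv_X_succ]

lemma polyT_T : polyT n (Tv k n) = Polynomial.X := by
  rw [polyT, AlgEquiv.trans_apply, renameEquiv_apply, Tv, rename_X, finRotate_last,
    finSuccEquiv_X_zero]

lemma polyT_toT (r : MvPolynomial (Fin n) k) : polyT n (toT k r) = Polynomial.C r := by
  induction r using MvPolynomial.induction_on with
  | C a =>
    rw [toT, rename_C, ← algebraMap_eq, AlgEquiv.commutes]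
    rfl
  | add p q hp hq => rw [map_add, map_add, hp, hq, map_add]
  | mul_X p i hp =>
    rw [map_mul, map_mul, hp, map_mul, toT, rename_X, polyT_X_castSucc]

/-- The coefficient of `T ^ i`. -/
def coT (i : ℕ) : MvPolynomial (Fin (n + 1)) k →ₗ[k] MvPolynomial (Fin n) k :=
  ((Polynomial.lcoeff (MvPolynomial (Fin n) k) i).restrictScalars k) ∘ₗ (polyT n).toLinearMap

lemma coT_apply (i : ℕ) (p : MvPolynomial (Fin (n + 1)) k) : coT i p = (polyT n p).coeff i := rfl

lemma coT_toT_mul (i : ℕ) (r : MvPolynomial (Fin n) k) (p : MvPolynomial (Fin (n + 1)) k) :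
    coT i (toT k r * p) = r * coT i p := by
  rw [coT_apply, map_mul, polyT_toT, Polynomial.coeff_C_mul, coT_apply]

lemma coT_T_mul_zero (p : MvPolynomial (Fin (n + 1)) k) : coT 0 (Tv k n * p) = 0 := by
  rw [coT_apply, map_mul, polyT_T, Polynomial.coeff_X_mul_zero]

lemma coT_T_mul_succ (i : ℕ) (p : MvPolynomial (Fin (n + 1)) k) :
    coT (i + 1) (Tv k n * p) = coT i p := by
  rw [coT_apply, map_mul, polyT_T, Polynomial.coeff_X_mul, coT_apply]

lemma coT_pow_mul (i j : ℕ) (r : MvPolynomial (Fin n) k) :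
    coT i (Tv k n ^ j * toT k r) = if i = j then r else 0 := by
  rw [coT_apply, map_mul, map_pow, polyT_T, polyT_toT, mul_comm, Polynomial.coeff_C_mul_X_pow]

lemma coT_toT_zero (r : MvPolynomial (Fin n) k) : coT 0 (toT k r) = r := by
  rw [coT_apply, polyT_toT, Polynomial.coeff_C_zero]

lemma coT_toT_succ (i : ℕ) (r : MvPolynomial (Fin n) k) : coT (i + 1) (toT k r) = 0 := by
  rw [coT_apply, polyT_toT, Polynomial.coeff_C_succ]

lemma exists_expansion (p : MvPolynomial (Fin (n + 1)) k) :
    ∃ N : ℕ, p = ∑ i ∈ Finset.range N, Tv k n ^ i * toT k (coT i p) := by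
  refine ⟨(polyT n p).natDegree + 1, (polyT n).injective ?_⟩
  rw [map_sum]
  conv_lhs => rw [Polynomial.as_sum_range_C_mul_X_pow (polyT n p)]
  refine Finset.sum_congr rfl fun i _ => ?_
  rw [map_mul, map_pow, polyT_T, polyT_toT, mul_comm, coT_apply]

lemma toT_isHomogeneous {r : MvPolynomial (Fin n) k} {m : ℕ} (h : r.IsHomogeneous m) :
    (toT k r).IsHomogeneous m := h.rename_isHomogeneous

lemma T_isHomogeneous : (Tv k n).IsHomogeneous 1 := isHomogeneous_X k _

lemma T_pow_mul_isHomogeneous {r : MvPolynomial (Fin n) k} {i j m : ℕ} (h : r.IsHomogeneous j)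
    (hm : i + j = m) : (Tv k n ^ i * toT k r).IsHomogeneous m := by
  have := (T_isHomogeneous (k := k) (n := n)).pow i
  rw [one_mul] at this
  rw [← hm]
  exact this.mul (toT_isHomogeneous h)

lemma coT_isHomogeneous {p : MvPolynomial (Fin (n + 1)) k} {m i j : ℕ} (hp : p.IsHomogeneous m)
    (h : i + j = m) : (coT i p).IsHomogeneous j := by
  rw [coT_apply, polyT, AlgEquiv.trans_apply, renameEquiv_apply]
  exact (hp.rename_isHomogeneous (f := finRotate (n + 1))).finSuccEquiv_coeff_isHomogeneous i j h

lemma coT_eq_zero {p : MvPolynomial (Fin (n + 1)) k} {m i : ℕ} (hp : p.IsHomogeneous m)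
    (h : m < i) : coT i p = 0 := by
  rw [coT_apply, polyT, AlgEquiv.trans_apply, renameEquiv_apply]
  by_contra hc
  have h1 := totalDegree_coeff_finSuccEquiv_add_le _ _ hc
  have h2 := (hp.rename_isHomogeneous (f := finRotate (n + 1))).totalDegree_le
  omega

/-- The ideal of polynomials whose constant coefficient in `T` lies in the smaller ideal and whose
coefficients up to `T ^ q` lie in the larger one. -/
def JT {J J' : Ideal (MvPolynomial (Fin n) k)} (h : J ≤ J') (q : ℕ) :
    Ideal (MvPolynomial (Fin (n + 1)) k) where
  carrier := {p | coT 0 p ∈ J ∧ ∀ i ≤ q, coT i p ∈ J'}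
  zero_mem' := by simp
  add_mem' := by
    rintro a b ⟨h1, h2⟩ ⟨h3, h4⟩
    refine ⟨?_, fun i hi => ?_⟩
    · rw [map_add]; exact J.add_mem h1 h3
    · rw [map_add]; exact J'.add_mem (h2 i hi) (h4 i hi)
  smul_mem' := by
    rintro c a ⟨h1, h2⟩
    refine ⟨?_, fun i hi => ?_⟩
    · rw [smul_eq_mul, coT_apply, map_mul, Polynomial.mul_coeff_zero]
      exact J.mul_mem_left _ h1
    · rw [smul_eq_mul, coT_apply, map_mul, Polynomial.coeff_mul]
      refine J'.sum_mem fun x hx => J'.mul_mem_left _ (h2 _ ?_)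
      have := Finset.HasAntidiagonal.mem_antidiagonal.1 hx
      omega

section JT

variable {J J' : Ideal (MvPolynomial (Fin n) k)} {h : J ≤ J'} {q : ℕ}

lemma mem_JT {p : MvPolynomial (Fin (n + 1)) k} :
    p ∈ JT h q ↔ coT 0 p ∈ J ∧ ∀ i < q, coT (i + 1) p ∈ J' := by
  constructor
  · rintro ⟨h1, h2⟩
    exact ⟨h1, fun i hi => h2 _ (by omega)⟩
  · rintro ⟨h1, h2⟩
    refine ⟨h1, fun i hi => ?_⟩
    cases i with
    | zero => exact h h1
    | succ i => exact h2 i (by omega)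

lemma T_pow_mul_mem_JT {i : ℕ} {r : MvPolynomial (Fin n) k} (h0 : i = 0 → r ∈ J)
    (h1 : i ≤ q → r ∈ J') : Tv k n ^ i * toT k r ∈ JT h q := by
  refine ⟨?_, fun j hj => ?_⟩
  · rw [coT_pow_mul]
    split_ifs with hi
    · exact h0 hi.symm
    · exact J.zero_mem
  · rw [coT_pow_mul]
    split_ifs with hi
    · exact h1 (hi ▸ hj)
    · exact J'.zero_mem

lemma JT_isHom (hJ : IsHom J) (hJ' : IsHom J') : IsHom (JT h q) := by
  intro p hp m
  obtain ⟨N, hN⟩ := exists_expansion p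
  rw [hN, map_sum]
  refine Ideal.sum_mem _ fun i _ => ?_
  have hT := (T_isHomogeneous (k := k) (n := n)).pow i
  rw [one_mul] at hT
  rcases lt_or_ge m i with hm | hm
  · rw [hc_mul_lt hT _ hm]
    exact Ideal.zero_mem _
  · obtain ⟨j, rfl⟩ := Nat.exists_eq_add_of_le hm
    rw [hc_mul hT, toT, ← rename_homogeneousComponent]
    refine T_pow_mul_mem_JT (fun h0 => ?_) fun hi => ?_
    · rw [h0]; exact hJ _ hp.1 _
    · exact hJ' _ (hp.2 i hi) _

end JT

lemma JT_eq {I I' L : Ideal (MvPolynomial (Fin n) k)} (h : I ⊔ L ≤ I' ⊔ L) (q : ℕ) :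
    extI k I ⊔ Ideal.span {Tv k n ^ (q + 1)} ⊔ TmulI k I' ⊔ Ideal.map (toT k) L = JT h q := by
  have hx : ∀ r ∈ I ⊔ L, toT k r ∈ JT h q := by
    intro r hr
    have := T_pow_mul_mem_JT (h := h) (q := q) (i := 0) (r := r) (fun _ => hr) (fun _ => h hr)
    rwa [pow_zero, one_mul] at this
  apply le_antisymm
  · refine sup_le (sup_le (sup_le ?_ ?_) ?_) ?_
    · exact Ideal.map_le_iff_le_comap.2 fun r hr => hx r (Ideal.mem_sup_left hr)
    · rw [Ideal.span_singleton_le_iff_mem]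
      have := T_pow_mul_mem_JT (h := h) (q := q) (i := q + 1) (r := 1) (by omega) (by omega)
      rwa [map_one, mul_one] at this
    · rw [TmulI, Ideal.span_le]
      rintro _ ⟨r, hr, rfl⟩
      have := T_pow_mul_mem_JT (h := h) (q := q) (i := 1) (r := r) (by omega)
        (fun _ => Ideal.mem_sup_left hr)
      rwa [pow_one] at this
    · exact Ideal.map_le_iff_le_comap.2 fun r hr => hx r (Ideal.mem_sup_right hr)
  · intro p hp
    obtain ⟨N, hN⟩ := exists_expansion p
    rw [hN]
    refine Ideal.sum_mem _ fun i _ => ?_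
    rcases Nat.eq_zero_or_pos i with rfl | hi
    · refine Ideal.mul_mem_left _ _ ?_
      obtain ⟨a, ha, b, hb, hab⟩ := Submodule.mem_sup.1 hp.1
      rw [← hab, map_add]
      exact Ideal.add_mem _
        (Ideal.mem_sup_left (Ideal.mem_sup_left (Ideal.mem_sup_left (Ideal.mem_map_of_mem _ ha))))
        (Ideal.mem_sup_right (Ideal.mem_map_of_mem _ hb))
    · obtain ⟨j, rfl⟩ : ∃ j, i = j + 1 := ⟨i - 1, by omega⟩
      rcases le_or_gt (j + 1) q with hq | hq
      · obtain ⟨a, ha, b, hb, hab⟩ := Submodule.mem_sup.1 (hp.2 _ hq)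
        rw [← hab, map_add, mul_add]
        refine Ideal.add_mem _ ?_ (Ideal.mul_mem_left _ _
          (Ideal.mem_sup_right (Ideal.mem_map_of_mem _ hb)))
        rw [pow_succ (Tv k n) j, mul_assoc]
        exact Ideal.mul_mem_left _ _ (Ideal.mem_sup_left (Ideal.mem_sup_right
          (Ideal.subset_span ⟨a, ha, rfl⟩)))
      · obtain ⟨t, ht⟩ := Nat.exists_eq_add_of_le (show q + 1 ≤ j + 1 by omega)
        rw [ht, pow_add (Tv k n) (q + 1), mul_assoc]
        exact Ideal.mul_mem_right _ _ (Ideal.mem_sup_left (Ideal.mem_sup_left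
          (Ideal.mem_sup_right (Ideal.mem_span_singleton_self _))))

/-- The form `ℓ + t T`. -/
def addT (l : MvPolynomial (Fin n) k) (t : k) : MvPolynomial (Fin (n + 1)) k :=
  toT k l + C t * Tv k n

lemma linForm_snoc (c : Fin n → k) (t : k) :
    linForm k (Fin.snoc c t : Fin (n + 1) → k) = addT (linForm k c) t := by
  rw [linForm, Fin.sum_univ_castSucc, addT, linForm, map_sum, Fin.snoc_last, Tv]
  congr 1
  refine Finset.sum_congr rfl fun i _ => ?_
  rw [map_mul, toT, rename_C, rename_X, Fin.snoc_castSucc]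

lemma coT_C_mul (i : ℕ) (t : k) (p : MvPolynomial (Fin (n + 1)) k) :
    coT i (C t * p) = C t * coT i p := by
  rw [← smul_eq_C_mul, map_smul, smul_eq_C_mul]

lemma coT_addT_zero (l : MvPolynomial (Fin n) k) (t : k) (p : MvPolynomial (Fin (n + 1)) k) :
    coT 0 (addT l t * p) = l * coT 0 p := by
  rw [addT, add_mul, map_add, coT_toT_mul, mul_assoc, coT_C_mul, coT_T_mul_zero, mul_zero,
    add_zero]

lemma coT_addT_succ (i : ℕ) (l : MvPolynomial (Fin n) k) (t : k)
    (p : MvPolynomial (Fin (n + 1)) k) :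
    coT (i + 1) (addT l t * p) = l * coT (i + 1) p + C t * coT i p := by
  rw [addT, add_mul, map_add, coT_toT_mul, mul_assoc, coT_C_mul, coT_T_mul_succ]

section Lefschetz

variable {J J' : Ideal (MvPolynomial (Fin n) k)} {h : J ≤ J'} {q : ℕ}
variable {l : MvPolynomial (Fin n) k} {t : k}

lemma mem_of_C_mul_mem {S : Ideal (MvPolynomial ι k)} {p : MvPolynomial ι k} (ht : t ≠ 0)
    (hp : C t * p ∈ S) : p ∈ S := by
  have := S.mul_mem_left (C t⁻¹) hp
  rwa [← mul_assoc, ← C_mul, inv_mul_cancel₀ ht, C_1, one_mul] at this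

lemma addT_isHomogeneous (hl : l.IsHomogeneous 1) : (addT l t).IsHomogeneous 1 := by
  rw [addT]
  refine (toT_isHomogeneous hl).add ?_
  have := (isHomogeneous_C (Fin (n + 1)) t).mul (T_isHomogeneous (k := k) (n := n))
  rwa [zero_add] at this

lemma inj_JT (ht : t ≠ 0) {m : ℕ} (hA : Inj J l m)
    (hB : ∀ j, j + q = m → Inj J' (l ^ q) j) : Inj (JT h q) (addT l t) m := by
  intro p hp hω
  rw [mem_JT] at hω
  obtain ⟨h0, h1⟩ := hω
  rw [coT_addT_zero] at h0
  have p0 : coT 0 p ∈ J := hA _ (coT_isHomogeneous hp (zero_add m)) h0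
  have e : ∀ i < q, l * coT (i + 1) p + C t * coT i p ∈ J' := fun i hi => by
    rw [← coT_addT_succ]; exact h1 i hi
  have up : ∀ i ≤ q, l ^ i * coT i p ∈ J' := by
    intro i
    induction i with
    | zero => intro _; rw [pow_zero, one_mul]; exact h p0
    | succ i ih =>
      intro hi
      have e1 : l ^ (i + 1) * coT (i + 1) p =
          l ^ i * (l * coT (i + 1) p + C t * coT i p) - C t * (l ^ i * coT i p) := by ring
      rw [e1]
      exact J'.sub_mem (J'.mul_mem_left _ (e i hi)) (J'.mul_mem_left _ (ih (by omega)))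
  have pq : coT q p ∈ J' := by
    rcases lt_or_ge m q with hm | hm
    · rw [coT_eq_zero hp hm]; exact J'.zero_mem
    · exact hB (m - q) (by omega) _ (coT_isHomogeneous hp (by omega)) (up q le_rfl)
  have down : ∀ i ≤ q, coT (q - i) p ∈ J' := by
    intro i
    induction i with
    | zero => intro _; exact pq
    | succ i ih =>
      intro hi
      have h2 := e (q - (i + 1)) (by omega)
      rw [show q - (i + 1) + 1 = q - i by omega] at h2
      have h3 := J'.sub_mem h2 (J'.mul_mem_left l (ih (by omega)))
      rw [add_sub_cancel_left] at h3
      exact mem_of_C_mul_mem ht h3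
  refine mem_JT.2 ⟨p0, fun i hi => ?_⟩
  have := down (q - (i + 1)) (by omega)
  rwa [show q - (q - (i + 1)) = i + 1 by omega] at this

lemma inj_pow_of_inj_JT (hq : 1 ≤ q) (hl : l.IsHomogeneous 1) (ht : t ≠ 0) {m j : ℕ}
    (hC : Inj (JT h q) (addT l t) m) (hj : j + q = m) : Inj J' (l ^ q) j := by
  intro b hb hlb
  have key : ∀ i < q, (C ((-t⁻¹) ^ (q - 1 - i)) * (l ^ (q - 1 - i) * b)).IsHomogeneous
      (q - 1 - i + j) := fun i _ => by
    have h1 := (hl.pow (q - 1 - i)).mul hb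
    have h2 := (isHomogeneous_C (Fin n) ((-t⁻¹) ^ (q - 1 - i))).mul h1
    rwa [zero_add, one_mul] at h2
  set p : MvPolynomial (Fin (n + 1)) k := ∑ i ∈ Finset.range q,
    Tv k n ^ (i + 1) * toT k (C ((-t⁻¹) ^ (q - 1 - i)) * (l ^ (q - 1 - i) * b)) with hp
  have hpm : p.IsHomogeneous m := IsHomogeneous.sum _ _ _ fun i hi => by
    have := Finset.mem_range.1 hi
    exact T_pow_mul_isHomogeneous (key i this) (by omega)
  have c0 : coT 0 p = 0 := by
    rw [hp, map_sum]
    refine Finset.sum_eq_zero fun i _ => ?_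
    rw [coT_pow_mul, if_neg (by omega)]
  have cs : ∀ i < q, coT (i + 1) p = C ((-t⁻¹) ^ (q - 1 - i)) * (l ^ (q - 1 - i) * b) := by
    intro i hi
    rw [hp, map_sum, Finset.sum_eq_single i]
    · rw [coT_pow_mul, if_pos rfl]
    · intro b' _ hb'
      rw [coT_pow_mul, if_neg (by omega)]
    · intro hi'
      exact absurd (Finset.mem_range.2 hi) hi'
  have hpJ : p ∈ JT h q := by
    refine hC p hpm (mem_JT.2 ⟨?_, fun i hi => ?_⟩)
    · rw [coT_addT_zero, c0, mul_zero]; exact J.zero_mem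
    · rw [coT_addT_succ, cs i hi]
      rcases i with _ | i
      · rw [c0, mul_zero, add_zero]
        have e1 : l * (C ((-t⁻¹) ^ (q - 1 - 0)) * (l ^ (q - 1 - 0) * b)) =
            C ((-t⁻¹) ^ (q - 1 - 0)) * (l ^ q * b) := by
          rw [show l ^ q = l * l ^ (q - 1 - 0) by rw [← pow_succ']; congr 1; omega]
          ring
        rw [e1]
        exact J'.mul_mem_left _ hlb
      · rw [cs i (by omega)]
        obtain ⟨a, ha⟩ : ∃ a, q - 1 - i = a + 1 := ⟨q - 2 - i, by omega⟩
        rw [ha, show q - 1 - (i + 1) = a by omega]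
        have e1 : C t * (C ((-t⁻¹) ^ (a + 1)) * (l ^ (a + 1) * b)) =
            - (l * (C ((-t⁻¹) ^ a) * (l ^ a * b))) := by
          have : t * (-t⁻¹) ^ (a + 1) = - (-t⁻¹) ^ a := by
            rw [pow_succ]; field_simp
          rw [← mul_assoc, ← C_mul, this, C_neg]
          ring
        rw [e1, add_neg_cancel]
        exact J'.zero_mem
  have := (mem_JT.1 hpJ).2 (q - 1) (by omega)
  rwa [cs _ (by omega), Nat.sub_self, pow_zero, pow_zero, C_1, one_mul, one_mul] at this

lemma sur_of_sur_JT {m : ℕ} (hC : Sur (JT h q) (addT l t) m) : Sur J l m := by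
  intro y hy
  obtain ⟨r, hr⟩ := mem_sup_span_singleton'.1 (hC _ (toT_isHomogeneous hy))
  have := (mem_JT.1 hr).1
  rw [map_sub, coT_toT_zero, coT_addT_zero] at this
  exact mem_sup_span_singleton'.2 ⟨_, this⟩

lemma sur_JT (hJ : IsHom J) (hq : 1 ≤ q) (hl : l.IsHomogeneous 1) (ht : t ≠ 0)
    {m : ℕ} (hA : Sur J l (m + 1)) (hB : Sur J' (l ^ q) m) :
    Sur (JT h q) (addT l t) (m + 1) := by
  set E := JT h q ⊔ Ideal.span {addT l t} with hE
  have hω : addT l t ∈ E := Ideal.mem_sup_right (Ideal.mem_span_singleton_self _)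
  have hJE : JT h q ≤ E := le_sup_left
  have step : ∀ x, Tv k n * x ∈ E → toT k l * x ∈ E := fun x hx => by
    have e1 : toT k l * x = addT l t * x - C t * (Tv k n * x) := by rw [addT]; ring
    rw [e1]
    exact E.sub_mem (E.mul_mem_right _ hω) (E.mul_mem_left _ hx)
  have step' : ∀ x, toT k l * x ∈ E → Tv k n * x ∈ E := fun x hx => by
    refine mem_of_C_mul_mem ht ?_
    have e1 : C t * (Tv k n * x) = addT l t * x - toT k l * x := by rw [addT]; ring
    rw [e1]
    exact E.sub_mem (E.mul_mem_right _ hω) hx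
  have lpow : ∀ i x, Tv k n ^ i * x ∈ E → toT k l ^ i * x ∈ E := by
    intro i
    induction i with
    | zero => intro x hx; simpa using hx
    | succ i ih =>
      intro x hx
      rw [pow_succ' (toT k l), mul_assoc]
      apply step
      rw [mul_left_comm]
      apply ih
      rwa [← mul_assoc, ← pow_succ]
  have lpow' : ∀ i x, toT k l ^ i * x ∈ E → Tv k n ^ i * x ∈ E := by
    intro i
    induction i with
    | zero => intro x hx; simpa using hx
    | succ i ih =>
      intro x hx
      rw [pow_succ' (Tv k n), mul_assoc]
      apply step'
      rw [mul_left_comm]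
      apply ih
      rwa [← mul_assoc, ← pow_succ]
  have hT : ∀ s : MvPolynomial (Fin n) k, s.IsHomogeneous m → Tv k n * toT k s ∈ E := by
    intro s hs
    obtain ⟨u, hu⟩ := mem_sup_span_singleton'.1 (hB s hs)
    have e1 : Tv k n * toT k s = Tv k n ^ 1 * toT k (s - l ^ q * u) +
        toT k l ^ q * (Tv k n * toT k u) := by
      rw [map_sub, map_mul, map_pow]; ring
    rw [e1]
    refine E.add_mem (hJE (T_pow_mul_mem_JT (by omega) fun _ => hu)) (lpow _ _ (hJE ?_))
    rw [← mul_assoc, ← pow_succ]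
    exact T_pow_mul_mem_JT (by omega) (by omega)
  intro y hy
  obtain ⟨N, hN⟩ := exists_expansion y
  rw [hN]
  refine E.sum_mem fun i _ => ?_
  rcases lt_or_ge (m + 1) i with hi | hi
  · rw [coT_eq_zero hy hi, map_zero, mul_zero]; exact E.zero_mem
  have hr := coT_isHomogeneous hy (show i + (m + 1 - i) = m + 1 by omega)
  rcases i with _ | i
  · rw [pow_zero, one_mul]
    obtain ⟨s, hs, hys⟩ := hJ.exists_homogeneous_factor hl (m := m)
      (by rw [add_comm 1 m]; exact hr) (hA _ hr)
    have e1 : toT k (coT 0 y) = Tv k n ^ 0 * toT k (coT 0 y - l * s) + toT k l * toT k s := by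
      rw [pow_zero, one_mul, map_sub, map_mul]; ring
    rw [e1]
    exact E.add_mem (hJE (T_pow_mul_mem_JT (fun _ => hys) fun _ => h hys))
      (step _ (hT s hs))
  · rw [pow_succ (Tv k n), mul_assoc]
    apply lpow'
    rw [mul_left_comm, ← map_pow, ← map_mul]
    apply hT
    have := (hl.pow i).mul hr
    rwa [one_mul, show i + (m + 1 - (i + 1)) = m by omega] at this

lemma sur_pow_of_sur_JT (hJ : IsHom J) (hJ' : IsHom J') (hq : 1 ≤ q) (hl : l.IsHomogeneous 1)
    (ht : t ≠ 0) {m : ℕ} (hC : Sur (JT h q) (addT l t) (m + 1)) (hA : Inj J l m) :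
    Sur J' (l ^ q) m := by
  intro y hy
  have hTy := T_pow_mul_isHomogeneous (i := 1) hy (add_comm 1 m)
  obtain ⟨p, hp, hyp⟩ := (JT_isHom (h := h) (q := q) hJ hJ').exists_homogeneous_factor
    (addT_isHomogeneous (t := t) hl) (m := m) (by rwa [add_comm 1 m]) (hC _ hTy)
  obtain ⟨h0, h1⟩ := mem_JT.1 hyp
  rw [map_sub, coT_pow_mul, if_neg (by omega), coT_addT_zero, zero_sub, neg_mem_iff] at h0
  have p0 : coT 0 p ∈ J' := h (hA _ (coT_isHomogeneous hp (zero_add m)) h0)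
  have y1 : y - l * coT 1 p ∈ J' := by
    have := h1 0 (by omega)
    rw [map_sub, coT_pow_mul, if_pos rfl, coT_addT_succ, ← sub_sub, zero_add] at this
    have h2 := J'.add_mem this (J'.mul_mem_left (C t) p0)
    rwa [sub_add_cancel] at h2
  have e : ∀ i, 1 ≤ i → i < q → l * coT (i + 1) p + C t * coT i p ∈ J' := fun i hi hiq => by
    have := h1 i hiq
    rwa [map_sub, coT_pow_mul, if_neg (by omega), coT_addT_succ, zero_sub, neg_mem_iff] at this
  set E := J' ⊔ Ideal.span {l ^ q} with hE
  have hJE : J' ≤ E := le_sup_left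
  have down : ∀ i < q, l ^ (q - i) * coT (q - i) p ∈ E := by
    intro i
    induction i with
    | zero =>
      intro _
      exact E.mul_mem_right _ (Ideal.mem_sup_right (Ideal.mem_span_singleton_self _))
    | succ i ih =>
      intro hi
      have h2 := hJE (e (q - (i + 1)) (by omega) (by omega))
      have h3 := ih (by omega)
      rw [show q - i = q - (i + 1) + 1 by omega] at h3
      set a := q - (i + 1)
      refine mem_of_C_mul_mem ht ?_
      have e1 : C t * (l ^ a * coT a p) = l ^ a * (l * coT (a + 1) p + C t * coT a p)
          - l ^ (a + 1) * coT (a + 1) p := by ring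
      rw [e1]
      exact E.sub_mem (E.mul_mem_left _ h2) h3
  have h2 := down (q - 1) (by omega)
  rw [show q - (q - 1) = 1 by omega, pow_one] at h2
  have := E.add_mem (hJE y1) h2
  rwa [sub_add_cancel] at this

end Lefschetz

section Duality

variable {J J' : Ideal (MvPolynomial (Fin n) k)} {h : J ≤ J'} {q : ℕ}

/-- The pairing on `R[T] ⧸ JT` induced by functionals on the socle degrees of the two
quotients of `R`. -/
def pairT (φ ψ : MvPolynomial (Fin n) k →ₗ[k] k) (q : ℕ) :
    MvPolynomial (Fin (n + 1)) k →ₗ[k] MvPolynomial (Fin (n + 1)) k →ₗ[k] k :=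
  ((LinearMap.mul k (MvPolynomial (Fin n) k)).compr₂ φ).compl₁₂ (coT 0) (coT 0) +
    ∑ i ∈ Finset.range q,
      ((LinearMap.mul k (MvPolynomial (Fin n) k)).compr₂ ψ).compl₁₂ (coT (i + 1)) (coT (q - i))

lemma pairT_apply (φ ψ : MvPolynomial (Fin n) k →ₗ[k] k) (q : ℕ)
    (p y : MvPolynomial (Fin (n + 1)) k) :
    pairT φ ψ q p y = φ (coT 0 p * coT 0 y) +
      ∑ i ∈ Finset.range q, ψ (coT (i + 1) p * coT (q - i) y) := by
  simp [pairT, LinearMap.sum_apply]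

lemma pairT_comm (φ ψ : MvPolynomial (Fin n) k →ₗ[k] k) (q : ℕ)
    (p y : MvPolynomial (Fin (n + 1)) k) : pairT φ ψ q p y = pairT φ ψ q y p := by
  rw [pairT_apply, pairT_apply, mul_comm (coT 0 p), ← Finset.sum_range_reflect]
  congr 1
  refine Finset.sum_congr rfl fun i hi => ?_
  have := Finset.mem_range.1 hi
  rw [show q - 1 - i + 1 = q - i by omega, show q - (q - 1 - i) = i + 1 by omega, mul_comm]

lemma pairT_eq_zero_iff {d s : ℕ} (hA : PD J d) (hB : PD J' s) (hs : s + q + 1 = d)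
    {φ ψ : MvPolynomial (Fin n) k →ₗ[k] k}
    (hφ : ∀ r : MvPolynomial (Fin n) k, r.IsHomogeneous d → (r ∈ J ↔ φ r = 0))
    (hψ : ∀ r : MvPolynomial (Fin n) k, r.IsHomogeneous s → (r ∈ J' ↔ ψ r = 0))
    {j m : ℕ} (hjm : j + m = d) {p : MvPolynomial (Fin (n + 1)) k} (hp : p.IsHomogeneous j) :
    (∀ y : MvPolynomial (Fin (n + 1)) k, y.IsHomogeneous m → pairT φ ψ q p y = 0) ↔
      p ∈ JT h q := by
  constructor
  · intro H
    refine mem_JT.2 ⟨?_, fun i hi => ?_⟩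
    · by_contra hc
      have hp0 := coT_isHomogeneous hp (zero_add j)
      obtain ⟨t, r, hjt, hr, hrp⟩ := hA.1 j _ hp0 hc
      obtain rfl : t = m := by omega
      have := H (toT k r) (toT_isHomogeneous hr)
      rw [pairT_apply, coT_toT_zero, Finset.sum_eq_zero, add_zero, mul_comm] at this
      · refine hrp ((hφ _ ?_).2 this)
        rw [← hjt, add_comm j t]
        exact hr.mul hp0
      · intro i hi
        have := Finset.mem_range.1 hi
        obtain ⟨a, ha⟩ : ∃ a, q - i = a + 1 := ⟨q - i - 1, by omega⟩
        rw [ha, coT_toT_succ, mul_zero, map_zero]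
    · by_contra hc
      rcases lt_or_ge j (i + 1) with hij | hij
      · rw [coT_eq_zero hp hij] at hc
        exact hc J'.zero_mem
      have hpi := coT_isHomogeneous hp (show i + 1 + (j - (i + 1)) = j by omega)
      obtain ⟨t, r, hjt, hr, hrp⟩ := hB.1 _ _ hpi hc
      have := H _ (T_pow_mul_isHomogeneous (i := q - i) hr (show q - i + t = m by omega))
      rw [pairT_apply, coT_pow_mul, if_neg (by omega), mul_zero, map_zero, zero_add,
        Finset.sum_eq_single i, coT_pow_mul, if_pos rfl, mul_comm] at this
      · refine hrp ((hψ _ ?_).2 this)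
        rw [← hjt, add_comm _ t]
        exact hr.mul hpi
      · intro a ha hai
        have := Finset.mem_range.1 ha
        rw [coT_pow_mul, if_neg (by omega), mul_zero, map_zero]
      · intro hi'
        exact absurd (Finset.mem_range.2 hi) hi'
  · intro hpJ y hy
    obtain ⟨h0, h1⟩ := mem_JT.1 hpJ
    rw [pairT_apply, Finset.sum_eq_zero, add_zero]
    · refine (hφ _ ?_).1 (J.mul_mem_right _ h0)
      rw [← hjm]
      exact (coT_isHomogeneous hp (zero_add j)).mul (coT_isHomogeneous hy (zero_add m))
    · intro i hi
      have hi := Finset.mem_range.1 hi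
      rcases lt_or_ge j (i + 1) with hij | hij
      · rw [coT_eq_zero hp hij, zero_mul, map_zero]
      rcases lt_or_ge m (q - i) with him | him
      · rw [coT_eq_zero hy him, mul_zero, map_zero]
      refine (hψ _ ?_).1 (J'.mul_mem_right _ (h1 i hi))
      have := (coT_isHomogeneous hp (show i + 1 + (j - (i + 1)) = j by omega)).mul
        (coT_isHomogeneous hy (show q - i + (m - (q - i)) = m by omega))
      rwa [show j - (i + 1) + (m - (q - i)) = s by omega] at this

lemma finrank_qComp_JT {d s : ℕ} (hA : PD J d) (hB : PD J' s) (hs : s + q + 1 = d)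
    {j m : ℕ} (hjm : j + m = d) :
    Module.finrank k (qComp k (JT h q) j) = Module.finrank k (qComp k (JT h q) m) := by
  obtain ⟨φ, hφ⟩ := hA.exists_functional
  obtain ⟨ψ, hψ⟩ := hB.exists_functional
  refine finrank_qComp_eq ((pairT φ ψ q).domRestrict₁₂ _ _) (fun p => ?_) fun y => ?_
  · rw [← pairT_eq_zero_iff hA hB hs hφ hψ hjm p.2]
    exact ⟨fun H y hy => LinearMap.congr_fun H ⟨y, hy⟩, fun H => LinearMap.ext fun y => H y y.2⟩
  · rw [← pairT_eq_zero_iff hA hB hs hφ hψ (show m + j = d by omega) y.2]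
    refine ⟨fun H p hp => ?_, fun H => LinearMap.ext fun p => ?_⟩
    · rw [pairT_comm]
      exact LinearMap.congr_fun H ⟨p, hp⟩
    · have := H p p.2
      rw [pairT_comm] at this
      exact this

end Duality

section Core

variable {J J' : Ideal (MvPolynomial (Fin n) k)} {h : J ≤ J'} {q : ℕ}
variable {l : MvPolynomial (Fin n) k} {t : k}

lemma Inj.pow_of_forall {S : Ideal (MvPolynomial ι k)} {θ : MvPolynomial ι k}
    (hθ : θ.IsHomogeneous 1) {j : ℕ} : ∀ a : ℕ, (∀ i < a, Inj S θ (j + i)) → Inj S (θ ^ a) j := by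
  intro a
  induction a with
  | zero => intro _ p _ hp; rwa [pow_zero, one_mul] at hp
  | succ a ih =>
    intro H p hp hθp
    refine ih (fun i hi => H i (by omega)) p hp (H a (by omega) _ ?_ ?_)
    · have := (hθ.pow a).mul hp
      rwa [one_mul, add_comm a] at this
    · rwa [← mul_assoc, ← pow_succ' θ a]

/-- Under duality the maximal rank property in all degrees is determined by the middle degree. -/
lemma PD.maxRank_iff {S : Ideal (MvPolynomial ι k)} {d : ℕ} (hA : PD S d) {θ : MvPolynomial ι k}
    (hθ : θ.IsHomogeneous 1) :
    (∀ m, Inj S θ m ∨ Sur S θ (m + 1)) ↔ ∀ j, j ≤ (d - 1) / 2 → j < d → Inj S θ j := by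
  constructor
  · intro H j hj hjd
    rcases H ((d - 1) / 2) with hi | hs
    · exact hA.inj_down hj (by omega) hi
    · have := hA.inj_of_sur (j := d - 1 - (d - 1) / 2) (by omega) hs
      exact hA.inj_down (by omega) (by omega) this
  · intro H m
    rcases lt_or_ge m d with hm | hm
    · rcases le_or_gt m ((d - 1) / 2) with h1 | h1
      · exact Or.inl (H m h1 hm)
      · exact Or.inr (hA.sur_of_inj hθ (j := d - (m + 1)) (by omega) (H _ (by omega) (by omega)))
    · exact Or.inr (hA.sur_of_gt (by omega))

lemma maxRank_JT_iff (hJ : IsHom J) (hJ' : IsHom J') (hq : 1 ≤ q) {d s : ℕ} (hA : PD J d)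
    (hB : PD J' s) (hs : s + q + 1 = d) (hl : l.IsHomogeneous 1) (ht : t ≠ 0) :
    (∀ m, Inj (JT h q) (addT l t) m ∨ Sur (JT h q) (addT l t) (m + 1)) ↔
      (∀ m, Inj J l m ∨ Sur J l (m + 1)) ∧ ∀ j, j + q = (d - 1) / 2 → Inj J' (l ^ q) j := by
  have hlq : (l ^ q).IsHomogeneous q := by
    have := hl.pow q
    rwa [one_mul] at this
  rw [hA.maxRank_iff hl]
  constructor
  · intro H
    suffices hmid : Inj J l ((d - 1) / 2) ∧ ∀ j, j + q = (d - 1) / 2 → Inj J' (l ^ q) j from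
      ⟨fun j hj _ => hA.inj_down hj (by omega) hmid.1, hmid.2⟩
    have hsur : Sur (JT h q) (addT l t) (d - (d - 1) / 2) → Inj J l ((d - 1) / 2) := fun hS =>
      hA.inj_of_sur (by omega) (sur_of_sur_JT hS)
    rcases H ((d - 1) / 2) with hi | hS
    · refine ⟨hsur ?_, fun j hj => inj_pow_of_inj_JT hq hl ht hi hj⟩
      have hω := addT_isHomogeneous (t := t) hl
      by_cases hS : Sur (JT h q) (addT l t) (d - (d - 1) / 2)
      · exact hS
      · obtain ⟨a, ha⟩ : ∃ a, d - (d - 1) / 2 = a + 1 + (d - 1) / 2 :=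
          ⟨d - (d - 1) / 2 - 1 - (d - 1) / 2, by omega⟩
        have hi' : ∀ i < a + 1, Inj (JT h q) (addT l t) ((d - 1) / 2 + i) := by
          intro i hia
          rcases Nat.eq_zero_or_pos i with rfl | hi0
          · exact hi
          · have h2 := H (d - (d - 1) / 2 - 1)
            rw [show d - (d - 1) / 2 - 1 + 1 = d - (d - 1) / 2 by omega] at h2
            have h3 := h2.resolve_right hS
            rwa [show (d - 1) / 2 + i = d - (d - 1) / 2 - 1 by omega]
        have hpow := Inj.pow_of_forall hω _ hi'
        have hωa := hω.pow (a + 1)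
        rw [one_mul] at hωa
        have hS' := sur_of_inj_of_finrank hωa hpow
          (finrank_qComp_JT hA hB hs (by omega))
        rw [← ha] at hS'
        intro y hy
        have hle : Ideal.span {addT l t ^ (a + 1)} ≤ Ideal.span {addT l t} := by
          rw [Ideal.span_singleton_le_span_singleton]
          exact dvd_pow_self _ (by omega)
        exact sup_le_sup_left hle _ (hS' y hy)
    · have hAi : Inj J l ((d - 1) / 2) := hA.inj_down (j' := d - 1 - (d - 1) / 2) (by omega)
        (by omega) (hA.inj_of_sur (by omega) (sur_of_sur_JT hS))
      refine ⟨hAi, fun j hj => ?_⟩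
      have h1 := sur_pow_of_sur_JT hJ hJ' hq hl ht hS hAi
      exact hB.inj_down (j' := s - (d - 1) / 2) (by omega) (by omega)
        (hB.inj_of_sur (by omega) h1)
  · rintro ⟨H, HB⟩ m
    rcases le_or_gt m ((d - 1) / 2) with hm | hm
    · refine Or.inl (inj_JT ht (H m hm (by omega)) fun j hj => ?_)
      exact hB.inj_down (j' := (d - 1) / 2 - q) (by omega) (by omega) (HB _ (by omega))
    · refine Or.inr (sur_JT hJ hq hl ht ?_ ?_)
      · rcases lt_or_ge m d with hmd | hmd
        · exact hA.sur_of_inj hl (j := d - (m + 1)) (by omega) (H _ (by omega) (by omega))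
        · exact hA.sur_of_gt (by omega)
      · rcases le_or_gt m s with hms | hms
        · exact hB.sur_of_inj hlq (j := s - m) (by omega)
            (hB.inj_down (j' := (d - 1) / 2 - q) (by omega) (by omega) (HB _ (by omega)))
        · exact hB.sur_of_gt hms

end Core

section Main

lemma redIdeal_eq (J : Ideal (MvPolynomial ι k)) {d : ℕ} (c : Fin d × ι → k) :
    redIdeal k J c = J ⊔ LI (Submodule.span k (Set.range fun j i => c (j, i))) := by
  rw [redIdeal, LI_span, ← Set.range_comp]
  rfl

lemma xForms_eq {d : ℕ} (c : Fin d × Fin n → k) :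
    xForms k c =
      Ideal.map (toT k) (LI (Submodule.span k (Set.range fun j i => c (j, i)))) := by
  rw [xForms, LI_span, ← Set.range_comp, Ideal.map_span, ← Set.range_comp]
  rfl

/-- Substitution of the value `t` for the last variable. -/
def evalLast (t : k) (g : MvPolynomial (Fin (n + 1)) k) : MvPolynomial (Fin n) k :=
  (polyT n g).eval (C t)

lemma eval_evalLast (c : Fin n → k) (t : k) (g : MvPolynomial (Fin (n + 1)) k) :
    eval c (evalLast t g) = eval (Fin.snoc c t : Fin (n + 1) → k) g := by
  induction g using MvPolynomial.induction_on with
  | C a =>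
    have := polyT_toT (n := n) (C a : MvPolynomial (Fin n) k)
    rw [toT, rename_C] at this
    rw [evalLast, this, Polynomial.eval_C, eval_C, eval_C]
  | add p q hp hq =>
    rw [evalLast] at hp hq ⊢
    rw [map_add, Polynomial.eval_add, map_add, hp, hq, map_add]
  | mul_X p i hp =>
    rw [evalLast] at hp ⊢
    rw [map_mul, Polynomial.eval_mul, map_mul, hp, map_mul, eval_X]
    congr 1
    refine Fin.lastCases ?_ (fun i => ?_) i
    · have := polyT_T (k := k) (n := n)
      rw [Tv] at this
      rw [this, Polynomial.eval_X, eval_C, Fin.snoc_last]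
    · rw [polyT_X_castSucc, Polynomial.eval_C, eval_X, Fin.snoc_castSucc]

lemma exists_evalLast_ne_zero [Infinite k] {g : MvPolynomial (Fin (n + 1)) k} (hg : g ≠ 0) :
    ∃ t : k, t ≠ 0 ∧ evalLast t g ≠ 0 := by
  have hP : polyT n g ≠ 0 := fun h0 => hg ((polyT n).injective (by rw [h0, map_zero]))
  have hfin : (C ⁻¹' {x | (polyT n g).IsRoot x} ∪ {0} : Set k).Finite :=
    ((Polynomial.finite_setOfPred_isRoot hP).preimage (C_injective (Fin n) k).injOn).union
      (Set.finite_singleton 0)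
  obtain ⟨t, ht⟩ := hfin.exists_notMem
  exact ⟨t, fun h0 => ht (Or.inr h0), fun h0 => ht (Or.inl h0)⟩

lemma artWLP_JT_iff [Infinite k] {J J' : Ideal (MvPolynomial (Fin n) k)} (h : J ≤ J') {q : ℕ}
    (hJ : IsHom J) (hJ' : IsHom J') (hq : 1 ≤ q) {d s : ℕ} (hA : PD J d)
    (hB : PD J' s) (hs : s + q + 1 = d) :
    artWLP k (JT h q) ↔ artWLP k J ∧ propM k J' q ((d - 1) / 2) := by
  have key : ∀ (c : Fin n → k) (t : k), t ≠ 0 →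
      ((∀ m, mulMaxRank k (JT h q) (Ideal.Quotient.mk _
        (linForm k (Fin.snoc c t : Fin (n + 1) → k))) m) ↔
      (∀ m, mulMaxRank k J (Ideal.Quotient.mk _ (linForm k c)) m) ∧
      ∀ x ∈ qCompZ k J' ((((d - 1) / 2 : ℕ) : ℤ) - (q : ℤ)),
        Ideal.Quotient.mk J' (linForm k c) ^ q * x = 0 → x = 0) := by
    intro c t ht
    have hl := linForm_isHomogeneous c
    rw [linForm_snoc, propM_iff]
    simp_rw [mulMaxRank_iff hJ hl,
      mulMaxRank_iff (JT_isHom (h := h) (q := q) hJ hJ') (addT_isHomogeneous (t := t) hl)]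
    exact maxRank_JT_iff hJ hJ' hq hA hB hs hl ht
  constructor
  · rintro ⟨g, hg, H⟩
    obtain ⟨t, ht, hgt⟩ := exists_evalLast_ne_zero hg
    have H' := fun c (hc : eval c (evalLast t g) ≠ 0) =>
      (key c t ht).1 (H _ (by rwa [eval_evalLast] at hc))
    exact ⟨⟨_, hgt, fun c hc => (H' c hc).1⟩, ⟨_, hgt, fun c hc => (H' c hc).2⟩⟩
  · rintro ⟨⟨g₁, hg₁, H₁⟩, ⟨g₂, hg₂, H₂⟩⟩
    refine ⟨toT k (g₁ * g₂) * Tv k n, mul_ne_zero ?_ (X_ne_zero _), fun c hc => ?_⟩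
    · rw [Ne, toT, map_eq_zero_iff _ (rename_injective _ (Fin.castSucc_injective n))]
      exact mul_ne_zero hg₁ hg₂
    · rw [map_mul, Tv, eval_X, toT, eval_rename, map_mul] at hc
      have h3 := right_ne_zero_of_mul hc
      have h2 := left_ne_zero_of_mul hc
      have := (key (Fin.init c) (c (Fin.last n)) h3).2
        ⟨H₁ _ (left_ne_zero_of_mul h2), H₂ _ (right_ne_zero_of_mul h2)⟩
      rwa [Fin.snoc_init_self] at this

end Main

end Auxiliary

/-- **Lemma.** `C` has the WLP iff `A` has the WLP and property `M_{q,p₁}`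
holds for `B`. -/
theorem wlp_C_iff_wlp_A_and_propM (k : Type) [Field k] [Infinite k]
    (n q d : ℕ) (hq : 1 ≤ q)
    (D : SC n) (hD : gorStar k D)
    (σ : Finset (Fin n)) (hσ : σ ∈ D.faces) (hcard : σ.card = q + 1)
    (hd : d = dimP D) :
    Generic k (Fin d × Fin n) fun c =>
      artWLP k (IC k D σ q ⊔ xForms k c) ↔
        (artWLP k (redIdeal k (srIdeal k D) c) ∧
          propM k (redIdeal k (linkIdeal k D σ) c) q ((d - 1) / 2)) := by
  subst hd
  obtain ⟨-, ⟨⟨-, hdepth⟩, g, hg, H⟩, hcone⟩ := hD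
  refine ⟨g, hg, fun c hc => ?_⟩
  have hgor : artGor k (redIdeal k (srIdeal k D) c) := H c hc
  beta_reduce
  rw [redIdeal_eq] at hgor
  rw [redIdeal_eq, redIdeal_eq, xForms_eq, linkIdeal_eq, IC, linkIdeal_eq]
  set U := Submodule.span k (Set.range fun j i => c (j, i)) with hU
  have hrank : Module.finrank k U ≤ dimP D := by
    have := finrank_range_le_card (R := k) (fun j i => c (j, i))
    rwa [Fintype.card_fin] at this
  have hne : ∅ ∈ D.faces := D.down_closed σ hσ _ (Finset.empty_subset σ)
  have hne' : ∅ ∈ (star σ D).faces := by rw [mem_star]; simpa using hσ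
  have hnil := nilX_of_artinian ((srIdeal_isHom D).sup (LI_isHom U)) hgor.1
  have hgood : Good D U :=
    ⟨regV_of_dep _ _ _ (srIdeal_isHom D) hrank hnil (dep_of_depthGE hdepth),
      gor1_of_artGor hgor, hnil⟩
  obtain ⟨hgood', hcol, -⟩ := hgood.star_face hcone hσ
  obtain ⟨d', hA⟩ := hgood.exists_PD hne
  obtain ⟨s, hB⟩ := hgood'.exists_PD hne'
  have hs := PD.degree_add hσ hcol hA hB
  rw [hcard] at hs
  obtain rfl := PD.dimP_eq hgood hcone hne hA
  have hle : srIdeal k D ⊔ LI U ≤ srIdeal k (star σ D) ⊔ LI U :=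
    sup_le_sup_right (srIdeal_le_star D σ) _
  rw [JT_eq hle]
  exact artWLP_JT_iff hle (Good.isHom D U) (Good.isHom _ U) hq hA hB (by omega)

end SRWLP
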